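/- Let $V$ be a separable Hilbert space, $H\in(1/2,1)$, $p\in[2,\infty)$, $-\infty\le a<b\le\infty$, and $-\infty\le\alpha<\beta\le\infty$. Let $f(t,x,\theta)$ be a $V$-valued function on $(a,b)\times\mathbb{R}^d\times(\alpha,\beta)$, jointly measurable, which (as a function of $(t,x)$ with values in $L^{1/H}((\alpha,\beta);V)$) is infinitely differentiable with compact support in $(a,b)\times\mathbb{R}^d$. Then $\int_{\mathbb{R}^d}\int_a^b\left[\int_a^t\left(\int_\alpha^\beta\|\nabla T_{t-s}f(s,\cdot,\theta)(x)\|^{1/H}\,d\theta\right)^{2H}ds\right]^{p/2}dt\,dx\;\le\;N\int_a^b\left[\int_\alpha^\beta\left(\int_{\mathbb{R}^d}\|f(t,x,\theta)\|_V^p\,dx\right)^{1/(pH)}d\theta\right]^{pH}dt,$ where $N$ is a constant depending only on $d$ and $p$. -/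

import Mathlib

open MeasureTheory ENNReal

/-- The heat kernel `G_t(x) = (4πt)^{-d/2} exp(-|x|²/(4t))` on `ℝ^d`. -/
noncomputable def heatKernel (d : ℕ) (t : ℝ) (x : EuclideanSpace ℝ (Fin d)) : ℝ :=
  (4 * Real.pi * t) ^ (-(d : ℝ)/2) * Real.exp (-‖x‖^2 / (4*t))

/-- The heat semigroup `T_t h (x) = ∫_{ℝ^d} h(x-y) G_t(y) dy` (Bochner integral). -/
noncomputable def heatOp (d : ℕ) {V : Type*} [NormedAddCommGroup V] [NormedSpace ℝ V]
    [CompleteSpace V] (t : ℝ) (h : EuclideanSpace ℝ (Fin d) → V)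
    (x : EuclideanSpace ℝ (Fin d)) : V :=
  ∫ y, heatKernel d t y • h (x - y)

/-- Squared norm of the spatial gradient of `T_t h` at `x`:
`‖∇ T_t h(x)‖² = ∑_{j=1}^d ‖∂_{x_j} T_t h(x)‖²`. -/
noncomputable def gradHeatNormSq (d : ℕ) {V : Type*} [NormedAddCommGroup V]
    [NormedSpace ℝ V] [CompleteSpace V] (t : ℝ) (h : EuclideanSpace ℝ (Fin d) → V)
    (x : EuclideanSpace ℝ (Fin d)) : ℝ :=
  ∑ j : Fin d, ‖fderiv ℝ (heatOp d t h) x (EuclideanSpace.single j 1)‖^2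

section HeatMeasure

variable {d : ℕ} {s t : ℝ}

theorem heatKernel_nonneg (ht : 0 < t) (x : EuclideanSpace ℝ (Fin d)) : 0 ≤ heatKernel d t x := by
  unfold heatKernel; positivity

theorem continuous_heatKernel : Continuous (heatKernel d t) := by
  unfold heatKernel; fun_prop

@[fun_prop]
theorem measurable_heatKernel : Measurable (heatKernel d t) :=
  continuous_heatKernel.measurable

theorem heatKernel_neg (x : EuclideanSpace ℝ (Fin d)) : heatKernel d t (-x) = heatKernel d t x := by
  simp [heatKernel]

theorem heatKernel_eq (x : EuclideanSpace ℝ (Fin d)) : heatKernel d t x =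
    (4 * Real.pi * t) ^ (-(d : ℝ)/2) * Real.exp (-(1 / (4 * t)) * ‖x‖ ^ 2) := by
  rw [heatKernel]; congr 2; ring

theorem integral_heatKernel (ht : 0 < t) : ∫ x, heatKernel d t x = 1 := by
  have h := GaussianFourier.integral_rexp_neg_mul_sq_norm
    (V := EuclideanSpace ℝ (Fin d)) (b := 1 / (4 * t)) (by positivity)
  simp_rw [heatKernel_eq]
  rw [integral_const_mul, h, finrank_euclideanSpace_fin,
    show Real.pi / (1 / (4 * t)) = 4 * Real.pi * t by field_simp, ← Real.rpow_add (by positivity)]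
  simp [neg_div]

theorem integrable_heatKernel (ht : 0 < t) : Integrable (heatKernel d t) :=
  .of_integral_ne_zero (by rw [integral_heatKernel ht]; exact one_ne_zero)

/-- The heat kernel as a measure. -/
noncomputable def heatMeasure (d : ℕ) (t : ℝ) : Measure (EuclideanSpace ℝ (Fin d)) :=
  volume.withDensity fun y => ENNReal.ofReal (heatKernel d t y)

theorem isProbabilityMeasure_heatMeasure (ht : 0 < t) : IsProbabilityMeasure (heatMeasure d t) := by
  constructor
  rw [heatMeasure, withDensity_apply _ .univ, Measure.restrict_univ,
    ← ofReal_integral_eq_lintegral_ofReal (integrable_heatKernel ht)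
    (.of_forall (heatKernel_nonneg ht)), integral_heatKernel ht, ofReal_one]

theorem integral_heatMeasure {V : Type*} [NormedAddCommGroup V] [NormedSpace ℝ V] (ht : 0 < t)
    (g : EuclideanSpace ℝ (Fin d) → V) :
    ∫ y, g y ∂heatMeasure d t = ∫ y, heatKernel d t y • g y := by
  rw [heatMeasure, integral_withDensity_eq_integral_toReal_smul
    continuous_heatKernel.measurable.ennreal_ofReal (by simp)]
  simp [ENNReal.toReal_ofReal (heatKernel_nonneg ht _)]

theorem lintegral_heatMeasure (g : EuclideanSpace ℝ (Fin d) → ℝ≥0∞) (hg : Measurable g) :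
    ∫⁻ y, g y ∂heatMeasure d t = ∫⁻ y, ENNReal.ofReal (heatKernel d t y) * g y :=
  lintegral_withDensity_eq_lintegral_mul _ continuous_heatKernel.measurable.ennreal_ofReal hg

theorem heatOp_eq {V : Type*} [NormedAddCommGroup V] [NormedSpace ℝ V] [CompleteSpace V]
    (ht : 0 < t) (h : EuclideanSpace ℝ (Fin d) → V) (x : EuclideanSpace ℝ (Fin d)) :
    heatOp d t h x = ∫ y, h (x - y) ∂heatMeasure d t :=
  (integral_heatMeasure ht _).symm

theorem charFun_heatMeasure (ht : 0 < t) (x : EuclideanSpace ℝ (Fin d)) :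
    charFun (heatMeasure d t) x = Complex.exp (-(t * ‖x‖ ^ 2 : ℝ)) := by
  have h := GaussianFourier.integral_cexp_neg_mul_sq_norm_add
    (V := EuclideanSpace ℝ (Fin d)) (b := (1 / (4 * t) : ℝ))
    (by rw [Complex.ofReal_re]; positivity) Complex.I x
  rw [charFun_apply, integral_heatMeasure ht]
  have e : ∀ y : EuclideanSpace ℝ (Fin d),
      heatKernel d t y • Complex.exp (inner ℝ y x * Complex.I) =
      ((4 * Real.pi * t) ^ (-(d : ℝ)/2) : ℝ) *
        Complex.exp (-((1 / (4 * t) : ℝ) : ℂ) * ‖y‖ ^ 2 + Complex.I * inner ℝ x y) := by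
    intro y
    rw [heatKernel_eq, Complex.real_smul, Complex.exp_add, real_inner_comm]
    push_cast
    ring_nf
  simp_rw [e]
  rw [integral_const_mul, h, finrank_euclideanSpace_fin, ← mul_assoc]
  have e2 : ((Real.pi : ℂ) / ((1 / (4 * t) : ℝ) : ℂ)) ^ ((d : ℂ) / 2) =
      (((4 * Real.pi * t) ^ ((d : ℝ)/2) : ℝ) : ℂ) := by
    rw [Complex.ofReal_cpow (by positivity)]
    congr 1
    · push_cast; field_simp
    · push_cast; rfl
  rw [e2, ← Complex.ofReal_mul, ← Real.rpow_add (by positivity)]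
  have : (t : ℂ) ≠ 0 := by exact_mod_cast ht.ne'
  simp [neg_div]
  field_simp

theorem heatMeasure_conv (hs : 0 < s) (ht : 0 < t) :
    (heatMeasure d s).conv (heatMeasure d t) = heatMeasure d (s + t) := by
  have := isProbabilityMeasure_heatMeasure (d := d) hs
  have := isProbabilityMeasure_heatMeasure (d := d) ht
  have := isProbabilityMeasure_heatMeasure (d := d) (add_pos hs ht)
  refine Measure.ext_of_charFun ?_
  ext x
  rw [charFun_conv, charFun_heatMeasure hs, charFun_heatMeasure ht,
    charFun_heatMeasure (add_pos hs ht), ← Complex.exp_add]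
  push_cast
  ring_nf

end HeatMeasure

section HeatAverages

variable {d : ℕ} {s t : ℝ}

local notation "E" => EuclideanSpace ℝ (Fin d)

/-- The heat semigroup acting on `[0,∞]`-valued functions. -/
noncomputable def heatAvg (d : ℕ) (t : ℝ) (g : EuclideanSpace ℝ (Fin d) → ℝ≥0∞)
    (x : EuclideanSpace ℝ (Fin d)) : ℝ≥0∞ :=
  ∫⁻ y, g (x - y) ∂heatMeasure d t

instance : SFinite (heatMeasure d t) := by unfold heatMeasure; infer_instance

theorem measurable_heatAvg_prod {α : Type*} [MeasurableSpace α] {g : α → E → ℝ≥0∞}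
    (hg : Measurable (Function.uncurry g)) :
    Measurable fun q : α × E => heatAvg d t (g q.1) q.2 := by
  unfold heatAvg
  refine Measurable.lintegral_prod_right' (f := fun q : (α × E) × E => g q.1.1 (q.1.2 - q.2)) ?_
  exact hg.comp (f := fun q : (α × E) × E => (q.1.1, q.1.2 - q.2)) (by fun_prop)

theorem measurable_heatAvg {g : E → ℝ≥0∞} (hg : Measurable g) : Measurable (heatAvg d t g) :=
  (measurable_heatAvg_prod (α := Unit) (g := fun _ => g) (hg.comp measurable_snd)).comp
    (measurable_prodMk_left (x := ()))

theorem heatAvg_eq {g : E → ℝ≥0∞} (hg : Measurable g) (x : E) :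
    heatAvg d t g x = ∫⁻ y, ENNReal.ofReal (heatKernel d t y) * g (x - y) :=
  lintegral_heatMeasure _ (hg.comp (by fun_prop))

theorem lintegral_heatAvg_mul {g φ : E → ℝ≥0∞} (hg : Measurable g) (hφ : Measurable φ) :
    ∫⁻ x, heatAvg d t g x * φ x = ∫⁻ x, g x * heatAvg d t φ x := by
  have hk : Measurable fun y : E => ENNReal.ofReal (heatKernel d t y) :=
    continuous_heatKernel.measurable.ennreal_ofReal
  have M₁ : Measurable fun q : E × E =>
      ENNReal.ofReal (heatKernel d t q.2) * g (q.1 - q.2) * φ q.1 := by fun_prop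
  have M₂ : Measurable fun q : E × E =>
      ENNReal.ofReal (heatKernel d t q.1) * g q.2 * φ (q.2 + q.1) := by fun_prop
  simp_rw [heatAvg_eq hg, heatAvg_eq hφ]
  calc ∫⁻ x, (∫⁻ y, ENNReal.ofReal (heatKernel d t y) * g (x - y)) * φ x
      = ∫⁻ x, ∫⁻ y, ENNReal.ofReal (heatKernel d t y) * g (x - y) * φ x := by
        refine lintegral_congr fun x => (lintegral_mul_const _ (by fun_prop)).symm
    _ = ∫⁻ y, ∫⁻ x, ENNReal.ofReal (heatKernel d t y) * g (x - y) * φ x :=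
        lintegral_lintegral_swap M₁.aemeasurable
    _ = ∫⁻ y, ∫⁻ x, ENNReal.ofReal (heatKernel d t y) * g x * φ (x + y) := by
        refine lintegral_congr fun y => ?_
        rw [← lintegral_add_right_eq_self _ y]
        simp
    _ = ∫⁻ x, ∫⁻ y, ENNReal.ofReal (heatKernel d t y) * g x * φ (x + y) :=
        lintegral_lintegral_swap M₂.aemeasurable
    _ = ∫⁻ x, g x * ∫⁻ y, ENNReal.ofReal (heatKernel d t y) * φ (x - y) := by
        refine lintegral_congr fun x => ?_
        rw [← lintegral_const_mul _ (by fun_prop), ← lintegral_neg_eq_self]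
        refine lintegral_congr fun y => ?_
        rw [heatKernel_neg, ← sub_eq_add_neg]
        ring

theorem heatAvg_one (ht : 0 < t) (x : E) : heatAvg d t (fun _ => 1) x = 1 := by
  have := isProbabilityMeasure_heatMeasure (d := d) ht
  simp [heatAvg]

theorem lintegral_heatAvg (ht : 0 < t) {g : E → ℝ≥0∞} (hg : Measurable g) :
    ∫⁻ x, heatAvg d t g x = ∫⁻ x, g x := by
  simpa [heatAvg_one ht] using
    lintegral_heatAvg_mul (t := t) hg (measurable_const (a := (1 : ℝ≥0∞)))

theorem heatKernel_le_heatKernel (hs : 0 < s) (hst : s ≤ t) (x : E) :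
    heatKernel d s x ≤ (t / s) ^ ((d : ℝ) / 2) * heatKernel d t x := by
  have ht : 0 < t := hs.trans_le hst
  unfold heatKernel
  rw [← mul_assoc]
  have e : (t / s) ^ ((d : ℝ) / 2) * (4 * Real.pi * t) ^ (-(d : ℝ)/2) =
      (4 * Real.pi * s) ^ (-(d : ℝ)/2) := by
    rw [neg_div, Real.rpow_neg (by positivity), Real.rpow_neg (by positivity),
      ← Real.inv_rpow (by positivity), ← Real.inv_rpow (by positivity),
      ← Real.mul_rpow (by positivity) (by positivity)]
    congr 1
    field_simp
  rw [e]
  gcongr ?_ * Real.exp ?_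
  rw [neg_div, neg_div, neg_le_neg_iff]
  gcongr

theorem heatAvg_le_heatAvg (hs : 0 < s) (hst : s ≤ t) {g : E → ℝ≥0∞} (hg : Measurable g) (x : E) :
    heatAvg d s g x ≤ ENNReal.ofReal ((t / s) ^ ((d : ℝ) / 2)) * heatAvg d t g x := by
  have hk : Measurable fun y : E => ENNReal.ofReal (heatKernel d t y) :=
    continuous_heatKernel.measurable.ennreal_ofReal
  have ht : 0 < t := hs.trans_le hst
  rw [heatAvg_eq hg, heatAvg_eq hg, ← lintegral_const_mul _ (by fun_prop)]
  refine lintegral_mono fun y => ?_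
  rw [← mul_assoc, ← ofReal_mul (by positivity)]
  gcongr
  exact heatKernel_le_heatKernel hs hst y

theorem heatAvg_rpow_half_le (ht : 0 < t) {g : E → ℝ≥0∞} (hg : Measurable g) (x : E) :
    heatAvg d t (fun y => g y ^ (1 / 2 : ℝ)) x ≤ heatAvg d t g x ^ (1 / 2 : ℝ) := by
  have := isProbabilityMeasure_heatMeasure (d := d) ht
  have h := lintegral_mul_norm_pow_le (μ := heatMeasure d t) (f := fun y => g (x - y))
    (g := fun _ => 1) (by fun_prop) (by fun_prop) (p := 1 / 2) (q := 1 / 2)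
    (by norm_num) (by norm_num) (by norm_num)
  simpa [heatAvg] using h

end HeatAverages

section HeatVector

variable {d : ℕ} {s t : ℝ} {V : Type*} [NormedAddCommGroup V]

local notation "E" => EuclideanSpace ℝ (Fin d)

/-- Bounded strongly measurable functions. -/
structure BddMeas (h : EuclideanSpace ℝ (Fin d) → V) : Prop where
  meas : StronglyMeasurable h
  bdd : ∃ C, ∀ x, ‖h x‖ ≤ C

theorem BddMeas.integrable {h : E → V} (hh : BddMeas h) {μ : Measure E} [IsFiniteMeasure μ] :
    Integrable h μ := by
  obtain ⟨C, hC⟩ := hh.bdd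
  exact Integrable.of_bound hh.meas.aestronglyMeasurable C (.of_forall hC)

theorem BddMeas.comp_sub {h : E → V} (hh : BddMeas h) (x : E) : BddMeas fun y => h (x - y) :=
  ⟨hh.meas.comp_measurable (by fun_prop), hh.bdd.imp fun _ hC _ => hC _⟩

theorem BddMeas.sub_const {h : E → V} (hh : BddMeas h) (c : V) : BddMeas fun y => h y - c :=
  ⟨hh.meas.sub stronglyMeasurable_const, by
    obtain ⟨C, hC⟩ := hh.bdd
    exact ⟨C + ‖c‖, fun x => (norm_sub_le _ _).trans (by gcongr; exact hC x)⟩⟩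

theorem BddMeas.norm_sq {h : E → V} (hh : BddMeas h) : BddMeas fun y => ‖h y‖ ^ 2 := by
  obtain ⟨C, hC⟩ := hh.bdd
  refine ⟨hh.meas.norm.pow 2, C ^ 2, fun x => ?_⟩
  rw [norm_pow, norm_norm]
  gcongr
  exact hC x

variable [NormedSpace ℝ V] [CompleteSpace V]

theorem stronglyMeasurable_heatOp_prod {α : Type*} [MeasurableSpace α] {h : α → E → V}
    (hh : StronglyMeasurable (Function.uncurry h)) :
    StronglyMeasurable fun q : α × E => heatOp d t (h q.1) q.2 := by
  unfold heatOp
  refine StronglyMeasurable.integral_prod_right'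
    (f := fun q : (α × E) × E => heatKernel d t q.2 • h q.1.1 (q.1.2 - q.2)) ?_
  refine StronglyMeasurable.smul ?_ ?_
  · exact continuous_heatKernel.stronglyMeasurable.comp_measurable measurable_snd
  · exact hh.comp_measurable (g := fun q : (α × E) × E => (q.1.1, q.1.2 - q.2)) (by fun_prop)

theorem stronglyMeasurable_heatOp {h : E → V} (hh : StronglyMeasurable h) :
    StronglyMeasurable (heatOp d t h) := by
  unfold heatOp
  refine StronglyMeasurable.integral_prod_right'
    (f := fun q : E × E => heatKernel d t q.2 • h (q.1 - q.2)) ?_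
  refine StronglyMeasurable.smul ?_ ?_
  · exact continuous_heatKernel.stronglyMeasurable.comp_measurable measurable_snd
  · exact hh.comp_measurable (g := fun q : E × E => q.1 - q.2) (by fun_prop)

theorem BddMeas.heatOp {h : E → V} (hh : BddMeas h) (ht : 0 < t) : BddMeas (heatOp d t h) := by
  have := isProbabilityMeasure_heatMeasure (d := d) ht
  obtain ⟨C, hC⟩ := hh.bdd
  refine ⟨stronglyMeasurable_heatOp hh.meas, C, fun x => ?_⟩
  rw [heatOp_eq ht]
  simpa using norm_integral_le_of_norm_le_const (μ := heatMeasure d t)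
    (f := fun y => h (x - y)) (.of_forall fun y => hC (x - y))

theorem heatOp_heatOp {h : E → V} (hh : BddMeas h) (hs : 0 < s) (ht : 0 < t) :
    heatOp d s (heatOp d t h) = heatOp d (s + t) h := by
  have := isProbabilityMeasure_heatMeasure (d := d) hs
  have := isProbabilityMeasure_heatMeasure (d := d) ht
  ext x
  rw [heatOp_eq hs, heatOp_eq (add_pos hs ht), ← heatMeasure_conv hs ht,
    integral_conv (hh.comp_sub x).integrable]
  simp_rw [heatOp_eq ht, sub_sub]

/-- The variance of `h` with respect to the heat kernel centred at `x`. -/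
noncomputable def heatVar (d : ℕ) {V : Type*} [NormedAddCommGroup V] [NormedSpace ℝ V]
    [CompleteSpace V] (t : ℝ) (h : EuclideanSpace ℝ (Fin d) → V)
    (x : EuclideanSpace ℝ (Fin d)) : ℝ≥0∞ :=
  ∫⁻ y, ‖h (x - y) - heatOp d t h x‖ₑ ^ 2 ∂heatMeasure d t

theorem measurable_heatVar_prod {α : Type*} [MeasurableSpace α] {h : α → E → V}
    (hh : StronglyMeasurable (Function.uncurry h)) :
    Measurable fun q : α × E => heatVar d t (h q.1) q.2 := by
  unfold heatVar
  refine Measurable.lintegral_prod_right'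
    (f := fun q : (α × E) × E => ‖h q.1.1 (q.1.2 - q.2) - heatOp d t (h q.1.1) q.1.2‖ₑ ^ 2) ?_
  refine (StronglyMeasurable.sub ?_ ?_).enorm.pow_const 2
  · exact hh.comp_measurable (g := fun q : (α × E) × E => (q.1.1, q.1.2 - q.2)) (by fun_prop)
  · exact (stronglyMeasurable_heatOp_prod hh).comp_measurable measurable_fst

theorem measurable_heatVar {h : E → V} (hh : StronglyMeasurable h) :
    Measurable (heatVar d t h) := by
  unfold heatVar
  refine Measurable.lintegral_prod_right'
    (f := fun q : E × E => ‖h (q.1 - q.2) - heatOp d t h q.1‖ₑ ^ 2) ?_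
  refine (StronglyMeasurable.sub ?_ ?_).enorm.pow_const 2
  · exact hh.comp_measurable (g := fun q : E × E => q.1 - q.2) (by fun_prop)
  · exact (stronglyMeasurable_heatOp hh).comp_measurable measurable_fst

end HeatVector

section Gradient

variable {d : ℕ} {t b : ℝ} {V : Type*} [NormedAddCommGroup V]

local notation "E" => EuclideanSpace ℝ (Fin d)

theorem abs_exp_neg_sub_exp_neg_le {A B M : ℝ} (hA : M ≤ A) (hB : M ≤ B) :
    |Real.exp (-A) - Real.exp (-B)| ≤ |A - B| * Real.exp (-M) := by
  wlog h : A ≤ B generalizing A B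
  · rw [abs_sub_comm, abs_sub_comm A]; exact this hB hA (le_of_not_ge h)
  have h1 : Real.exp (-B) ≤ Real.exp (-A) := by gcongr
  rw [abs_of_nonneg (sub_nonneg.2 h1), abs_of_nonpos (sub_nonpos.2 h)]
  have h2 : Real.exp (-B) = Real.exp (-A) * Real.exp (-(B - A)) := by
    rw [← Real.exp_add]; ring_nf
  have h3 := Real.one_sub_le_exp_neg (B - A)
  have h4 : Real.exp (-A) ≤ Real.exp (-M) := by gcongr
  calc _ = Real.exp (-A) * (1 - Real.exp (-(B - A))) := by rw [h2]; ring
    _ ≤ Real.exp (-A) * (B - A) :=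
        mul_le_mul_of_nonneg_left (by linarith) (Real.exp_pos _).le
    _ ≤ Real.exp (-M) * (B - A) := mul_le_mul_of_nonneg_right h4 (by linarith)
    _ = _ := by ring

/-- The constant in the Lipschitz bound for the heat kernel. -/
noncomputable def heatLip (d : ℕ) : ℝ := 4 * Real.exp 1 * 2 ^ ((d : ℝ) / 2)

theorem heatLip_pos : 0 < heatLip d := by unfold heatLip; positivity

theorem abs_heatKernel_add_sub_le (hb : 0 < b) (y : E) {v : E} (hv : ‖v‖ ≤ √b) :
    |heatKernel d b (y + v) - heatKernel d b y| ≤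
      heatLip d * (‖v‖ / √b) * heatKernel d (2 * b) y := by
  obtain ⟨r, hr, rfl⟩ : ∃ r : ℝ, 0 < r ∧ b = r ^ 2 := ⟨√b, by positivity, by simp [hb.le]⟩
  rw [Real.sqrt_sq hr.le] at *
  have e1 : (4 * Real.pi * r ^ 2) ^ (-(d : ℝ)/2) =
      2 ^ ((d : ℝ) / 2) * (4 * Real.pi * (2 * r ^ 2)) ^ (-(d : ℝ)/2) := by
    rw [show 4 * Real.pi * (2 * r ^ 2) = 2 * (4 * Real.pi * r ^ 2) by ring,
      Real.mul_rpow (x := 2) (y := 4 * Real.pi * r ^ 2) (by positivity) (by positivity), ← mul_assoc,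
      ← Real.rpow_add (by positivity)]
    simp [neg_div]
  have tri : |‖y + v‖ - ‖y‖| ≤ ‖v‖ := by simpa using abs_norm_sub_norm_le (y + v) y
  have key : |Real.exp (-(‖y + v‖ ^ 2 / (4 * r ^ 2))) - Real.exp (-(‖y‖ ^ 2 / (4 * r ^ 2)))| ≤
      4 * Real.exp 1 * (‖v‖ / r) * Real.exp (-(‖y‖ ^ 2 / (4 * (2 * r ^ 2)))) := by
    obtain ⟨w, hw⟩ : ∃ w, w = ‖y‖ / r := ⟨_, rfl⟩
    obtain ⟨z, hz⟩ : ∃ z, z = ‖y + v‖ / r := ⟨_, rfl⟩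
    obtain ⟨q, hq⟩ : ∃ q, q = ‖v‖ / r := ⟨_, rfl⟩
    have hw0 : 0 ≤ w := by rw [hw]; positivity
    have hz0 : 0 ≤ z := by rw [hz]; positivity
    have hq0 : 0 ≤ q := by rw [hq]; positivity
    have hq1 : q ≤ 1 := by rw [hq, div_le_one hr]; exact hv
    have hzw : |z - w| ≤ q := by
      rw [hz, hw, hq, ← sub_div, abs_div, abs_of_pos hr]; gcongr
    have eA : ‖y + v‖ ^ 2 / (4 * r ^ 2) = z ^ 2 / 4 := by rw [hz]; field_simp
    have eB : ‖y‖ ^ 2 / (4 * r ^ 2) = w ^ 2 / 4 := by rw [hw]; field_simp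
    have eC : ‖y‖ ^ 2 / (4 * (2 * r ^ 2)) = w ^ 2 / 8 := by rw [hw]; field_simp; ring
    rw [eA, eB, eC, ← hq]
    obtain ⟨hl, hu⟩ := abs_le.1 hzw
    have h1 := abs_exp_neg_sub_exp_neg_le (A := z ^ 2 / 4) (B := w ^ 2 / 4)
      (M := 3 * w ^ 2 / 16 - 1)
      (by nlinarith [sq_nonneg (4 * z - 3 * w), sq_nonneg (z - 3 * (w - z))])
      (by nlinarith)
    have h2 : |z ^ 2 / 4 - w ^ 2 / 4| ≤ q * (2 * w + 1) / 4 := by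
      rw [show z ^ 2 / 4 - w ^ 2 / 4 = (z - w) * (z + w) / 4 by ring, abs_div, abs_mul,
        abs_of_nonneg (add_nonneg hz0 hw0), abs_of_pos (by norm_num : (0 : ℝ) < 4)]
      have := mul_le_mul hzw (by linarith : z + w ≤ 2 * w + 1) (by positivity) hq0
      linarith
    have h3 : 2 * w + 1 ≤ 16 * Real.exp (w ^ 2 / 16) := by
      nlinarith [Real.add_one_le_exp (w ^ 2 / 16), sq_nonneg (w - 1)]
    calc _ ≤ _ := h1
      _ ≤ q * (16 * Real.exp (w ^ 2 / 16)) / 4 * Real.exp (-(3 * w ^ 2 / 16 - 1)) := by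
          gcongr
          exact h2.trans (by gcongr)
      _ = 4 * q * (Real.exp (w ^ 2 / 16) * Real.exp (-(3 * w ^ 2 / 16 - 1))) := by ring
      _ = 4 * q * (Real.exp 1 * Real.exp (-(w ^ 2 / 8))) := by
          rw [← Real.exp_add, ← Real.exp_add]; ring_nf
      _ = _ := by ring
  unfold heatKernel heatLip
  rw [e1, ← mul_sub, abs_mul, abs_of_nonneg (by positivity), neg_div (4 * r ^ 2),
    neg_div (4 * r ^ 2), neg_div (4 * (2 * r ^ 2))]
  calc _ ≤ 2 ^ ((d : ℝ) / 2) * (4 * Real.pi * (2 * r ^ 2)) ^ (-(d : ℝ)/2) *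
        (4 * Real.exp 1 * (‖v‖ / r) * Real.exp (-(‖y‖ ^ 2 / (4 * (2 * r ^ 2))))) := by
        gcongr
    _ = _ := by ring

variable [NormedSpace ℝ V]

theorem BddMeas.integrable_heatKernel_smul {u : E → V} (hu : BddMeas u) (ht : 0 < t) (v : E) :
    Integrable fun y => heatKernel d t (y + v) • u y := by
  obtain ⟨C, hC⟩ := hu.bdd
  refine ((integrable_heatKernel ht).comp_add_right v).smul_bdd C
    hu.meas.aestronglyMeasurable (.of_forall hC)

variable [CompleteSpace V]

/-- Spatial Lipschitz bound for `T_b u` in terms of the oscillation of `u` around any constant. -/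
theorem enorm_heatOp_add_sub_le (hb : 0 < b) {u : E → V} (hu : BddMeas u) (c : V) (x : E) {v : E}
    (hv : ‖v‖ ≤ √b) :
    ‖heatOp d b u (x + v) - heatOp d b u x‖ₑ ≤ ENNReal.ofReal (heatLip d * (‖v‖ / √b)) *
      heatAvg d (2 * b) (fun y => ‖u y - c‖ₑ ^ 2) x ^ (1 / 2 : ℝ) := by
  have hb2 : 0 < 2 * b := by positivity
  have hm : Measurable fun y => ‖u y - c‖ₑ := (hu.sub_const c).meas.enorm
  have hm' : Measurable fun y => ‖u (x - y) - c‖ₑ := ((hu.sub_const c).comp_sub x).meas.enorm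
  have e : ∀ w : E, heatOp d b u (x + w) - c = ∫ y, heatKernel d b (y + w) • (u (x - y) - c) := by
    intro w
    have h1 : heatOp d b u (x + w) = ∫ y, heatKernel d b (y + w) • u (x - y) := by
      rw [heatOp, ← integral_add_right_eq_self _ w]
      simp
    have h2 : c = ∫ y, heatKernel d b (y + w) • c := by
      rw [integral_smul_const, integral_add_right_eq_self (heatKernel d b), integral_heatKernel hb,
        one_smul]
    simp_rw [smul_sub]
    rw [integral_sub ((hu.comp_sub x).integrable_heatKernel_smul hb w)
      (((integrable_heatKernel hb).comp_add_right w).smul_const c), ← h1, ← h2]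
  have e2 : heatOp d b u (x + v) - heatOp d b u x =
      ∫ y, (heatKernel d b (y + v) - heatKernel d b y) • (u (x - y) - c) := by
    have h0 := e 0
    rw [add_zero] at h0
    rw [← sub_sub_sub_cancel_right _ _ c, e v, h0, ← integral_sub]
    · simp [sub_smul]
    · exact ((hu.sub_const c).comp_sub x).integrable_heatKernel_smul hb v
    · exact ((hu.sub_const c).comp_sub x).integrable_heatKernel_smul hb 0
  rw [e2]
  calc _ ≤ ∫⁻ y, ‖(heatKernel d b (y + v) - heatKernel d b y) • (u (x - y) - c)‖ₑ :=
        enorm_integral_le_lintegral_enorm _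
    _ ≤ ∫⁻ y, ENNReal.ofReal (heatLip d * (‖v‖ / √b)) *
          (ENNReal.ofReal (heatKernel d (2 * b) y) * ‖u (x - y) - c‖ₑ) := by
        refine lintegral_mono fun y => ?_
        rw [enorm_smul, ← mul_assoc, ← ofReal_mul (by have := heatLip_pos (d := d); positivity),
          Real.enorm_eq_ofReal_abs]
        gcongr
        exact abs_heatKernel_add_sub_le hb y hv
    _ = ENNReal.ofReal (heatLip d * (‖v‖ / √b)) *
          heatAvg d (2 * b) (fun y => (‖u y - c‖ₑ ^ 2) ^ (1 / 2 : ℝ)) x := by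
        rw [lintegral_const_mul _ (by fun_prop), heatAvg_eq (by fun_prop)]
        congr 1
        refine lintegral_congr fun y => ?_
        rw [← ENNReal.rpow_natCast, ← ENNReal.rpow_mul]
        norm_num
    _ ≤ _ := by
        gcongr
        exact heatAvg_rpow_half_le hb2 (by fun_prop) x

theorem ofReal_gradHeatNormSq_le {a b c : ℝ} (ha : 0 < a) (hb : 0 < b) (hc : 0 < c) {h : E → V}
    (hh : BddMeas h) (x : E) :
    ENNReal.ofReal (gradHeatNormSq d (a + (b + c)) h x) ≤
      ENNReal.ofReal (d * (heatLip d ^ 2 / b)) *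
        heatAvg d a (heatVar d (2 * b) (heatOp d c h)) x := by
  have hK := heatLip_pos (d := d)
  rcases Nat.eq_zero_or_pos d with hd | hd
  · subst hd; simp [gradHeatNormSq]
  set W := heatVar d (2 * b) (heatOp d c h) with hW
  have hWm : Measurable W := measurable_heatVar (stronglyMeasurable_heatOp hh.meas)
  have hu := hh.heatOp hc
  have hw := hu.heatOp hb
  have hF : heatOp d (a + (b + c)) h = heatOp d a (heatOp d b (heatOp d c h)) := by
    rw [heatOp_heatOp hh hb hc, heatOp_heatOp hh ha (add_pos hb hc)]
  set u := heatOp d c h with hu_def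
  set w := heatOp d b u with hw_def
  by_cases htop : heatAvg d a W x = ∞
  · rw [htop, mul_top (by simp only [ne_eq, ofReal_eq_zero, not_le]; positivity)]
    exact le_top
  set K := heatLip d / √b * (heatAvg d a W x).toReal ^ (1 / 2 : ℝ) with hKdef
  have hK0 : 0 ≤ K := by positivity
  have := isProbabilityMeasure_heatMeasure (d := d) ha
  have lip : ∀ v : E, ‖v‖ ≤ √b → ‖heatOp d a w (x + v) - heatOp d a w x‖ ≤ K * ‖v‖ := by
    intro v hv
    rw [← ENNReal.ofReal_le_ofReal_iff (by positivity), ofReal_norm]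
    calc ‖heatOp d a w (x + v) - heatOp d a w x‖ₑ
        = ‖∫ y, (w (x - y + v) - w (x - y)) ∂heatMeasure d a‖ₑ := by
          rw [heatOp_eq ha, heatOp_eq ha, ← integral_sub (hw.comp_sub _).integrable
            (hw.comp_sub _).integrable]
          simp_rw [sub_add_eq_add_sub]
      _ ≤ ∫⁻ y, ‖w (x - y + v) - w (x - y)‖ₑ ∂heatMeasure d a :=
          enorm_integral_le_lintegral_enorm _
      _ ≤ ∫⁻ y, ENNReal.ofReal (heatLip d * (‖v‖ / √b)) * W (x - y) ^ (1 / 2 : ℝ)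
            ∂heatMeasure d a :=
          lintegral_mono fun y => enorm_heatOp_add_sub_le hb hu _ _ hv
      _ = ENNReal.ofReal (heatLip d * (‖v‖ / √b)) *
            heatAvg d a (fun y => W y ^ (1 / 2 : ℝ)) x := by
          rw [lintegral_const_mul _ (by fun_prop)]; rfl
      _ ≤ ENNReal.ofReal (heatLip d * (‖v‖ / √b)) * heatAvg d a W x ^ (1 / 2 : ℝ) := by
          gcongr; exact heatAvg_rpow_half_le ha hWm x
      _ = ENNReal.ofReal (K * ‖v‖) := by
          rw [← ENNReal.ofReal_toReal htop, ENNReal.ofReal_rpow_of_nonneg (by positivity)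
            (by positivity), ← ofReal_mul (by positivity), hKdef]
          congr 1; ring
  have hfd : ‖fderiv ℝ (heatOp d a w) x‖ ≤ K := by
    refine norm_fderiv_le_of_lip' ℝ hK0 ?_
    filter_upwards [Metric.closedBall_mem_nhds x (Real.sqrt_pos.2 hb)] with z hz
    have := lip (z - x) (by rwa [← dist_eq_norm])
    rwa [add_sub_cancel] at this
  have hsum : gradHeatNormSq d (a + (b + c)) h x ≤ d * K ^ 2 := by
    unfold gradHeatNormSq
    rw [hF]
    calc _ ≤ ∑ _j : Fin d, K ^ 2 := by
          gcongr with j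
          calc _ ≤ ‖fderiv ℝ (heatOp d a w) x‖ * ‖EuclideanSpace.single j (1 : ℝ)‖ :=
                ContinuousLinearMap.le_opNorm _ _
            _ ≤ K := by simpa using hfd
      _ = _ := by simp
  refine (ofReal_le_ofReal hsum).trans (le_of_eq ?_)
  rw [← ENNReal.ofReal_toReal htop, ← ofReal_mul (by positivity), hKdef, mul_pow, div_pow, Real.sq_sqrt hb.le, ← Real.rpow_natCast (_ ^ _),
    ← Real.rpow_mul (by positivity), Nat.cast_ofNat, one_div_mul_cancel two_ne_zero, Real.rpow_one,
    mul_assoc (d : ℝ)]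

end Gradient

section Bellman

variable {d : ℕ} {t M : ℝ} {V : Type*} [NormedAddCommGroup V] [InnerProductSpace ℝ V]
  [CompleteSpace V]

local notation "E" => EuclideanSpace ℝ (Fin d)

/-- `F` is, on `[0, ∞) × [0, M]`, a supremum of affine functions `y * n + b * φ + c`
which may be chosen to satisfy `φ ≤ y` near the supremum. -/
structure IsBellman (M : ℝ) (F : ℝ → ℝ → ℝ≥0∞) : Prop where
  meas : Measurable (Function.uncurry F)
  exists_affine : ∀ n φ, 0 ≤ n → 0 ≤ φ → φ ≤ M → ∀ z, z = 0 ∨ z < F n φ →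
    ∃ y b c, φ ≤ y ∧ 0 ≤ y * n + b * φ + c ∧ z ≤ ENNReal.ofReal (y * n + b * φ + c) ∧
    ∀ n' φ', 0 ≤ n' → 0 ≤ φ' → φ' ≤ M → ENNReal.ofReal (y * n' + b * φ' + c) ≤ F n' φ'

theorem heatVar_eq_ofReal (ht : 0 < t) {h : E → V} (hh : BddMeas h) (x : E) :
    ∃ v, 0 ≤ v ∧ heatVar d t h x = ENNReal.ofReal v ∧
      ∫ y, ‖h (x - y)‖ ^ 2 ∂heatMeasure d t = ‖heatOp d t h x‖ ^ 2 + v := by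
  have := isProbabilityMeasure_heatMeasure (d := d) ht
  have hi := (hh.comp_sub x).integrable (μ := heatMeasure d t)
  have hi2 := (hh.comp_sub x).norm_sq.integrable (μ := heatMeasure d t)
  set c := heatOp d t h x with hc
  refine ⟨∫ y, ‖h (x - y) - c‖ ^ 2 ∂heatMeasure d t, by positivity, ?_, ?_⟩
  · rw [heatVar, ofReal_integral_eq_lintegral_ofReal
      ((hh.sub_const c).comp_sub x).norm_sq.integrable (.of_forall fun _ => by positivity)]
    refine lintegral_congr fun y => ?_
    rw [ofReal_pow (norm_nonneg _), ofReal_norm]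
  · have h1 : ∀ y, ‖h (x - y) - c‖ ^ 2 = ‖h (x - y)‖ ^ 2 - 2 * inner ℝ c (h (x - y)) + ‖c‖ ^ 2 := by
      intro y; rw [norm_sub_sq_real, real_inner_comm]
    simp_rw [h1]
    rw [integral_add (f := fun y => ‖h (x - y)‖ ^ 2 - 2 * inner ℝ c (h (x - y)))
        (hi2.sub ((hi.const_inner c).const_mul 2)) (integrable_const _),
      integral_sub hi2 ((hi.const_inner c).const_mul 2), integral_const_mul, integral_inner hi,
      ← heatOp_eq ht, ← hc, real_inner_self_eq_norm_sq]
    simp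
    ring

theorem heatOp_mem_Icc (ht : 0 < t) {m : E → ℝ} (hm : BddMeas m) (hm0 : ∀ x, 0 ≤ m x)
    (hmM : ∀ x, m x ≤ M) (x : E) : 0 ≤ heatOp d t m x ∧ heatOp d t m x ≤ M := by
  have := isProbabilityMeasure_heatMeasure (d := d) ht
  rw [heatOp_eq ht]
  refine ⟨integral_nonneg fun y => hm0 _, ?_⟩
  simpa using integral_mono (μ := heatMeasure d t) (hm.comp_sub x).integrable
    (integrable_const M) fun y => hmM _

theorem IsBellman.add_le_heatAvg {F : ℝ → ℝ → ℝ≥0∞} (hF : IsBellman M F) (ht : 0 < t) {h : E → V}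
    (hh : BddMeas h) {m : E → ℝ} (hm : BddMeas m) (hm0 : ∀ x, 0 ≤ m x) (hmM : ∀ x, m x ≤ M)
    (x : E) :
    F (‖heatOp d t h x‖ ^ 2) (heatOp d t m x) +
        heatVar d t h x * ENNReal.ofReal (heatOp d t m x) ≤
      heatAvg d t (fun y => F (‖h y‖ ^ 2) (m y)) x := by
  have := isProbabilityMeasure_heatMeasure (d := d) ht
  obtain ⟨v, hv0, hv, hvar⟩ := heatVar_eq_ofReal ht hh x
  obtain ⟨hφ0, hφM⟩ := heatOp_mem_Icc ht hm hm0 hmM x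
  have hi1 := (hm.comp_sub x).integrable (μ := heatMeasure d t)
  have hi2 := (hh.comp_sub x).norm_sq.integrable (μ := heatMeasure d t)
  have hmean : ∫ y, m (x - y) ∂heatMeasure d t = heatOp d t m x := (heatOp_eq ht m x).symm
  set φ := heatOp d t m x
  set n := ‖heatOp d t h x‖ ^ 2
  rw [hv, ← ofReal_mul hv0]
  have key : ∀ z, z = 0 ∨ z < F n φ → z + ENNReal.ofReal (v * φ) ≤
      heatAvg d t (fun y => F (‖h y‖ ^ 2) (m y)) x := by
    intro z hz
    obtain ⟨y, b, c, hy, hpos, hzy, hle⟩ := hF.exists_affine n φ (by positivity) hφ0 hφM z hz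
    calc z + ENNReal.ofReal (v * φ) ≤ ENNReal.ofReal (y * n + b * φ + c) +
          ENNReal.ofReal (v * φ) := by gcongr
      _ = ENNReal.ofReal (y * n + b * φ + c + v * φ) := (ofReal_add hpos (by positivity)).symm
      _ ≤ ENNReal.ofReal (∫ w, (y * ‖h (x - w)‖ ^ 2 + b * m (x - w) + c) ∂heatMeasure d t) := by
          rw [integral_add (f := fun w => y * ‖h (x - w)‖ ^ 2 + b * m (x - w))
              ((hi2.const_mul y).add (hi1.const_mul b)) (integrable_const _),
            integral_add (hi2.const_mul y) (hi1.const_mul b), integral_const_mul,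
            integral_const_mul, hvar, hmean]
          simp only [integral_const, probReal_univ, one_smul]
          refine ofReal_le_ofReal ?_
          nlinarith [mul_le_mul_of_nonneg_right hy hv0]
      _ ≤ ∫⁻ w, ENNReal.ofReal (y * ‖h (x - w)‖ ^ 2 + b * m (x - w) + c) ∂heatMeasure d t := by
          rw [integral_eq_lintegral_pos_part_sub_lintegral_neg_part
            (f := fun w => y * ‖h (x - w)‖ ^ 2 + b * m (x - w) + c) (((hi2.const_mul y).add
            (hi1.const_mul b)).add (integrable_const _))]
          exact (ofReal_le_ofReal (sub_le_self _ toReal_nonneg)).trans ofReal_toReal_le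
      _ ≤ _ := lintegral_mono fun w => hle _ _ (by positivity) (hm0 _) (hmM _)
  rw [← tsub_add_cancel_of_le ((zero_add _).symm.le.trans (key 0 (.inl rfl)))]
  gcongr
  exact le_of_forall_lt_imp_le_of_dense fun z hz =>
    ENNReal.le_sub_of_add_le_right ofReal_ne_top (key z (.inr hz))

theorem IsBellman.sum_le {F : ℝ → ℝ → ℝ≥0∞} (hF : IsBellman M F) {h : E → V}
    (hh : BddMeas h) {m : E → ℝ} (hm : BddMeas m) (hm0 : ∀ x, 0 ≤ m x) (hmM : ∀ x, m x ≤ M) :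
    ∑' k : ℤ, ∫⁻ x, heatVar d (4 * 2 ^ k) (heatOp d (4 * 2 ^ k) h) x *
        ENNReal.ofReal (heatOp d (8 * 2 ^ k) m x) ≤
      ∫⁻ x, F (‖h x‖ ^ 2) (m x) := by
  set A : ℤ → ℝ≥0∞ := fun k => ∫⁻ x, heatVar d (4 * 2 ^ k) (heatOp d (4 * 2 ^ k) h) x *
        ENNReal.ofReal (heatOp d (8 * 2 ^ k) m x) with hA
  set B : ℤ → ℝ≥0∞ := fun k =>
    ∫⁻ x, F (‖heatOp d (4 * 2 ^ k) h x‖ ^ 2) (heatOp d (4 * 2 ^ k) m x) with hB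
  have hpos : ∀ k : ℤ, (0 : ℝ) < 4 * 2 ^ k := fun k => by positivity
  have step : ∀ {t : ℝ} (_ : 0 < t) {u : E → V} (_ : BddMeas u) {w : E → ℝ} (_ : BddMeas w)
      (_ : ∀ x, 0 ≤ w x) (_ : ∀ x, w x ≤ M),
      (∫⁻ x, F (‖heatOp d t u x‖ ^ 2) (heatOp d t w x)) +
        ∫⁻ x, heatVar d t u x * ENNReal.ofReal (heatOp d t w x) ≤
      ∫⁻ x, F (‖u x‖ ^ 2) (w x) := by
    intro t ht u hu w hw hw0 hwM
    have hmeas : Measurable fun x => F (‖u x‖ ^ 2) (w x) :=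
      hF.meas.comp (hu.norm_sq.meas.measurable.prodMk hw.meas.measurable)
    rw [← lintegral_heatAvg ht hmeas, ← lintegral_add_right]
    · exact lintegral_mono fun x => hF.add_le_heatAvg ht hu hw hw0 hwM x
    · exact (measurable_heatVar hu.meas).mul (hw.heatOp ht).meas.measurable.ennreal_ofReal
  have hAB : ∀ k, B (k + 1) + A k ≤ B k := by
    intro k
    have := step (hpos k) (hh.heatOp (hpos k)) (hm.heatOp (hpos k))
      (fun x => (heatOp_mem_Icc (hpos k) hm hm0 hmM x).1)
      (fun x => (heatOp_mem_Icc (hpos k) hm hm0 hmM x).2)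
    rw [heatOp_heatOp hh (hpos k) (hpos k), heatOp_heatOp hm (hpos k) (hpos k),
      show (4 : ℝ) * 2 ^ k + 4 * 2 ^ k = 4 * 2 ^ (k + 1) by
        rw [zpow_add_one₀ two_ne_zero]; ring] at this
    rw [hA, hB]
    simp only
    rwa [show (8 : ℝ) * 2 ^ k = 4 * 2 ^ (k + 1) by rw [zpow_add_one₀ two_ne_zero]; ring]
  have hB0 : ∀ k, B k ≤ ∫⁻ x, F (‖h x‖ ^ 2) (m x) := fun k =>
    le_self_add.trans (step (hpos k) hh hm hm0 hmM)
  have hsum : ∀ (j : ℤ) (N : ℕ), B (j + N) + ∑ i ∈ Finset.range N, A (j + i) ≤ B j := by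
    intro j N
    induction N with
    | zero => simp
    | succ N ih =>
      rw [Finset.sum_range_succ, add_comm (∑ i ∈ _, _), ← add_assoc]
      refine le_trans ?_ ih
      gcongr
      simpa [add_assoc] using hAB (j + N)
  rw [ENNReal.tsum_eq_iSup_sum]
  refine iSup_le fun s => ?_
  obtain ⟨N, hN⟩ : ∃ N : ℕ, ∀ k ∈ s, |k| < N := by
    refine ⟨∑ k ∈ s, k.natAbs + 1, fun k hk => ?_⟩
    have := Finset.single_le_sum (f := fun k : ℤ => k.natAbs) (fun _ _ => Nat.zero_le _) hk
    rw [← Int.natCast_natAbs]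
    omega
  calc ∑ k ∈ s, A k ≤ ∑ k ∈ (Finset.range (2 * N)).image fun i : ℕ => (-N + i : ℤ), A k := by
        refine Finset.sum_le_sum_of_subset fun k hk => ?_
        have := abs_lt.1 (hN k hk)
        simp only [Finset.mem_image, Finset.mem_range]
        exact ⟨(k + N).toNat, by omega, by omega⟩
    _ = ∑ i ∈ Finset.range (2 * N), A (-N + i) :=
        Finset.sum_image fun i _ j _ hij => by simpa using hij
    _ ≤ B (-N) := le_add_self.trans (hsum (-N) (2 * N))
    _ ≤ _ := hB0 _

theorem isBellman_ofReal : IsBellman 1 fun n _ => ENNReal.ofReal n where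
  meas := by fun_prop
  exists_affine n φ _ _ hφ z hz := ⟨1, 0, 0, hφ, by simpa, by
    rcases hz with rfl | hz
    · simp
    · simpa using hz.le, by simp⟩

/-- The convex function controlling the square function for exponents `q' > 1`. -/
noncomputable def bellman (q n φ : ℝ) : ℝ≥0∞ :=
  ⨆ y : NNReal, ENNReal.ofReal (y * n + q * y ^ (q - 1) * φ + -((q - 1) * y ^ q))

theorem isBellman_bellman {κ q : ℝ} (hq : κ.HolderConjugate q) : IsBellman M (bellman q) where
  meas := by
    have : LowerSemicontinuous (Function.uncurry (bellman q)) := by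
      unfold bellman Function.uncurry
      refine lowerSemicontinuous_iSup fun y => Continuous.lowerSemicontinuous ?_
      exact ENNReal.continuous_ofReal.comp (by fun_prop)
    exact this.measurable
  exists_affine n φ hn hφ _ z hz := by
    have e1 : φ ^ (q - 1) * φ = φ ^ q := by
      rw [← Real.rpow_add_one' hφ (by linarith [hq.symm.pos])]; ring_nf
    have hnn : 0 ≤ φ * n + q * φ ^ (q - 1) * φ + -((q - 1) * φ ^ q) := by
      rw [mul_assoc q, e1]
      have : 0 ≤ φ ^ q := by positivity
      nlinarith [mul_nonneg hφ hn]
    have hmin : ∀ n' φ', ENNReal.ofReal (φ * n' + q * φ ^ (q - 1) * φ' + -((q - 1) * φ ^ q)) ≤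
        bellman q n' φ' := fun n' φ' => le_iSup_of_le ⟨φ, hφ⟩ le_rfl
    rcases hz with rfl | hz
    · exact ⟨φ, _, _, le_rfl, hnn, zero_le, fun n' φ' _ _ _ => hmin n' φ'⟩
    obtain ⟨y, hy⟩ := lt_iSup_iff.1 hz
    rcases le_or_gt φ y with h | h
    · exact ⟨y, _, _, h, (ofReal_pos.1 (bot_le.trans_lt hy)).le, hy.le,
        fun n' φ' _ _ _ => le_iSup_of_le y le_rfl⟩
    · refine ⟨φ, _, _, le_rfl, hnn, hy.le.trans (ofReal_le_ofReal ?_),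
        fun n' φ' _ _ _ => hmin n' φ'⟩
      have hy0 : (0 : ℝ) ≤ y := y.2
      have hq1 := hq.symm.lt
      have young := Real.young_inequality_of_nonneg hφ (Real.rpow_nonneg hy0 (q - 1)) hq.symm
      rw [← Real.rpow_mul hy0, hq.symm.sub_one_mul_conj] at young
      have e2 : q * (φ ^ q / q + (y : ℝ) ^ q / κ) = φ ^ q + (q - 1) * y ^ q := by
        rw [← hq.symm.div_conj_eq_sub_one]
        field_simp [hq.symm.ne_zero]
      have := mul_le_mul_of_nonneg_left young hq.symm.nonneg
      rw [e2] at this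
      nlinarith [mul_le_mul_of_nonneg_right h.le hn]

theorem exists_mul_le_rpow_add_rpow {κ q ε : ℝ} (hq : κ.HolderConjugate q) (hε : 0 < ε) :
    ∃ C, 0 ≤ C ∧ ∀ a b : ℝ, 0 ≤ a → 0 ≤ b → a * b ≤ C * a ^ κ + ε * b ^ q := by
  have hq0 := hq.symm.pos
  have hκ0 := hq.pos
  set δ := (ε * q) ^ (1 / q) with hδ
  have hδ0 : 0 < δ := by positivity
  refine ⟨(1 / δ) ^ κ / κ, by positivity, fun a b ha hb => ?_⟩
  have := Real.young_inequality_of_nonneg (a := a * (1 / δ)) (b := δ * b) (by positivity)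
    (by positivity) hq
  rw [Real.mul_rpow ha (by positivity), Real.mul_rpow hδ0.le hb, hδ, ← Real.rpow_mul (by positivity),
    one_div_mul_cancel hq0.ne', Real.rpow_one, ← hδ] at this
  calc a * b = a * (1 / δ) * (δ * b) := by field_simp
    _ ≤ _ := this
    _ = _ := by field_simp

theorem exists_bellman_le {κ q : ℝ} (hq : κ.HolderConjugate q) :
    ∃ C, 0 ≤ C ∧ ∀ n φ : ℝ, 0 ≤ n → 0 ≤ φ →
      bellman q n φ ≤ ENNReal.ofReal (C * (n ^ κ + φ ^ q)) := by
  have hq1 := hq.symm.lt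
  obtain ⟨C, hC, h1⟩ := exists_mul_le_rpow_add_rpow hq (ε := (q - 1) / 2) (by linarith)
  obtain ⟨D, hD, h2⟩ := exists_mul_le_rpow_add_rpow hq.symm (ε := (q - 1) / (2 * q))
    (div_pos (by linarith) (by linarith))
  refine ⟨C + q * D, by positivity, fun n φ hn hφ => iSup_le fun y => ofReal_le_ofReal ?_⟩
  have hy0 : (0 : ℝ) ≤ y := y.2
  have h1 := h1 n y hn hy0
  have h2 := h2 φ (y ^ (q - 1)) hφ (by positivity)
  rw [← Real.rpow_mul hy0, hq.symm.sub_one_mul_conj] at h2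
  have h3 := mul_le_mul_of_nonneg_left h2 (by linarith : 0 ≤ q)
  have e : q * ((q - 1) / (2 * q) * (y : ℝ) ^ q) = (q - 1) / 2 * y ^ q := by
    field_simp
  have p1 : 0 ≤ n ^ κ := by positivity
  have p2 : 0 ≤ φ ^ q := by positivity
  rw [mul_add, e] at h3
  have p3 := mul_nonneg hC p2
  have p4 := mul_nonneg (mul_nonneg (by linarith : 0 ≤ q) hD) p1
  linarith

end Bellman

section Maximal

/-- Forward maximal function along a geometric sequence of scales. -/
noncomputable def fwdMax (φ : ℝ → ℝ≥0∞) (s : ℝ) : ℝ≥0∞ :=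
  ⨆ k : ℤ, (ENNReal.ofReal (14 * 2 ^ k))⁻¹ * ∫⁻ r in Set.Ioc 0 (14 * 2 ^ k), φ (s + r)

theorem measurable_fwdMax_prod {α : Type*} [MeasurableSpace α] {φ : ℝ → α → ℝ≥0∞}
    (hφ : Measurable (Function.uncurry φ)) :
    Measurable fun q : ℝ × α => fwdMax (fun t => φ t q.2) q.1 := by
  unfold fwdMax
  refine Measurable.iSup fun k => Measurable.const_mul ?_ _
  exact Measurable.lintegral_prod_right' (f := fun q : (ℝ × α) × ℝ => φ (q.1.1 + q.2) q.1.2)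
    (hφ.comp (f := fun q : (ℝ × α) × ℝ => (q.1.1 + q.2, q.1.2)) (by fun_prop))

theorem measurable_fwdMax {φ : ℝ → ℝ≥0∞} (hφ : Measurable φ) : Measurable (fwdMax φ) :=
  (measurable_fwdMax_prod (α := Unit) (φ := fun t _ => φ t) (hφ.comp measurable_fst)).comp
    (measurable_prodMk_right (y := ()))

theorem fwdMax_mono {φ ψ : ℝ → ℝ≥0∞} (h : ∀ t, φ t ≤ ψ t) (s : ℝ) : fwdMax φ s ≤ fwdMax ψ s :=
  iSup_mono fun k => by
    gcongr
    exact h _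

theorem fwdMax_add_const_le {φ : ℝ → ℝ≥0∞} (c : ℝ≥0∞) (s : ℝ) :
    fwdMax (fun t => φ t + c) s ≤ fwdMax φ s + c := by
  refine iSup_le fun k => ?_
  have hk : (0 : ℝ) < 14 * 2 ^ k := by positivity
  rw [lintegral_add_right _ measurable_const, mul_add, setLIntegral_const, Real.volume_Ioc, sub_zero,
    mul_comm c, ← mul_assoc, ENNReal.inv_mul_cancel (by simpa using hk) ofReal_ne_top, one_mul]
  gcongr
  exact le_iSup (fun k : ℤ => (ENNReal.ofReal (14 * 2 ^ k))⁻¹ *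
    ∫⁻ r in Set.Ioc 0 (14 * 2 ^ k), φ (s + r)) k

theorem fwdMax_le_const {φ : ℝ → ℝ≥0∞} {c : ℝ≥0∞} (h : ∀ t, φ t ≤ c) (s : ℝ) :
    fwdMax φ s ≤ c := by
  refine (fwdMax_mono (ψ := fun _ => 0 + c) (by simpa using h) s).trans
    ((fwdMax_add_const_le (φ := fun _ => 0) c s).trans ?_)
  simp [fwdMax]

theorem lintegral_Ioc_le_mul_fwdMax (φ : ℝ → ℝ≥0∞) (s : ℝ) (k : ℤ) :
    ∫⁻ r in Set.Ioc 0 (14 * 2 ^ k), φ (s + r) ≤ ENNReal.ofReal (14 * 2 ^ k) * fwdMax φ s := by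
  have hk : (0 : ℝ) < 14 * 2 ^ k := by positivity
  calc _ = ENNReal.ofReal (14 * 2 ^ k) * ((ENNReal.ofReal (14 * 2 ^ k))⁻¹ *
        ∫⁻ r in Set.Ioc 0 (14 * 2 ^ k), φ (s + r)) := by
        rw [← mul_assoc, ENNReal.mul_inv_cancel (by simpa using hk) ofReal_ne_top, one_mul]
    _ ≤ _ := by
        gcongr
        exact le_iSup (fun k : ℤ => (ENNReal.ofReal (14 * 2 ^ k))⁻¹ *
          ∫⁻ r in Set.Ioc 0 (14 * 2 ^ k), φ (s + r)) k

/-- Weak-type bound for the forward maximal function. -/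
theorem mul_meas_fwdMax_le (g : ℝ → ℝ≥0∞) {c : ℝ≥0∞} (hc : c ≠ 0)
    (hc' : c ≠ ∞) : c * volume {s | c < fwdMax g s} ≤ 10 * ∫⁻ s, g s := by
  by_cases hI : ∫⁻ s, g s = ∞
  · rw [hI, mul_top (by norm_num)]; exact le_top
  set S := {s | c < fwdMax g s}
  have h1 : ∀ s : ℝ, ∃ R : ℝ, s ∈ S → 0 < R ∧
      c * ENNReal.ofReal R ≤ ∫⁻ r in Metric.closedBall s R, g r := by
    intro s
    by_cases hs : s ∈ S
    · obtain ⟨k, hk⟩ := lt_iSup_iff.1 (show c < fwdMax g s from hs)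
      have hk0 : (0 : ℝ) < 14 * 2 ^ k := by positivity
      refine ⟨14 * 2 ^ k, fun _ => ⟨hk0, ?_⟩⟩
      rw [mul_comm, ← div_eq_mul_inv] at hk
      refine (ENNReal.mul_le_of_le_div hk.le).trans ?_
      rw [← lintegral_indicator measurableSet_Ioc,
        ← lintegral_indicator Metric.isClosed_closedBall.measurableSet,
        ← lintegral_add_left_eq_self ((Metric.closedBall s (14 * 2 ^ k)).indicator g) s]
      refine lintegral_mono fun r => ?_
      by_cases hr : r ∈ Set.Ioc 0 (14 * (2 : ℝ) ^ k)
      · have : s + r ∈ Metric.closedBall s (14 * 2 ^ k) := by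
          simp [abs_of_pos hr.1, hr.2]
        simp [hr, this]
      · simp [hr]
    · exact ⟨0, fun h => absurd h hs⟩
  choose R hR using h1
  have hbound : ∀ s ∈ S, R s ≤ ((∫⁻ s, g s) / c).toReal := by
    intro s hs
    rw [← ENNReal.ofReal_le_iff_le_toReal (ENNReal.div_ne_top hI hc),
      ENNReal.le_div_iff_mul_le (.inl hc) (.inl hc'), mul_comm]
    exact (hR s hs).2.trans (setLIntegral_le_lintegral _ _)
  obtain ⟨u, huS, hdisj, hcov⟩ := Vitali.exists_disjoint_subfamily_covering_enlargement_closedBall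
    S id R _ hbound 5 (by norm_num)
  have hu : u.Countable := hdisj.countable_of_nonempty_interior fun s hs => by
    rw [interior_closedBall _ (hR s (huS hs)).1.ne']
    exact ⟨s, Metric.mem_ball_self (hR s (huS hs)).1⟩
  have := hu.to_subtype
  have hsub : S ⊆ ⋃ b : u, Metric.closedBall (b : ℝ) (5 * R b) := by
    intro s hs
    obtain ⟨b, hb, hsb⟩ := hcov s hs
    exact Set.mem_iUnion.2 ⟨⟨b, hb⟩, hsb (Metric.mem_closedBall_self (hR s hs).1.le)⟩
  calc c * volume S ≤ c * ∑' b : u, volume (Metric.closedBall (b : ℝ) (5 * R b)) := by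
        gcongr; exact (measure_mono hsub).trans (measure_iUnion_le _)
    _ = ∑' b : u, 10 * (c * ENNReal.ofReal (R b)) := by
        rw [← ENNReal.tsum_mul_left]
        refine tsum_congr fun b => ?_
        rw [Real.volume_closedBall, show 2 * (5 * R b) = 10 * R b by ring, ofReal_mul (by norm_num)]
        norm_num
        ring
    _ ≤ ∑' b : u, 10 * ∫⁻ r in Metric.closedBall (b : ℝ) (R b), g r := by
        refine ENNReal.tsum_le_tsum fun b => ?_
        gcongr
        exact (hR b (huS b.2)).2
    _ = 10 * ∫⁻ r in ⋃ b : u, Metric.closedBall (b : ℝ) (R b), g r := by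
        rw [ENNReal.tsum_mul_left, lintegral_iUnion (s := fun b : u => Metric.closedBall (b : ℝ) (R b))
          (fun b => Metric.isClosed_closedBall.measurableSet)
          (fun a b hab => hdisj a.2 b.2 (fun h => hab (Subtype.ext h)))]
    _ ≤ _ := mul_le_mul_right (setLIntegral_le_lintegral _ _) _

/-- Strong-type bound for the forward maximal function. -/
theorem lintegral_fwdMax_rpow_le {q : ℝ} (hq : 1 < q) {φ : ℝ → ℝ≥0∞} (hφ : Measurable φ)
    {M : ℝ≥0∞} (hM : M ≠ ∞) (hφM : ∀ t, φ t ≤ M) :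
    ∫⁻ s, fwdMax φ s ^ q ≤ ENNReal.ofReal (20 * q / (q - 1) * 2 ^ (q - 1)) * ∫⁻ t, φ t ^ q := by
  have hq1 : 0 < q - 1 := by linarith
  have fin : ∀ t, φ t ≠ ∞ := fun t => ((hφM t).trans_lt hM.lt_top).ne
  have finm : ∀ t, fwdMax φ t ≠ ∞ := fun t => ((fwdMax_le_const hφM t).trans_lt hM.lt_top).ne
  set ν := volume.withDensity φ
  have e1 : ∀ {x : ℝ≥0∞} {r : ℝ}, 0 ≤ r → x ≠ ∞ → x ^ r = ENNReal.ofReal (x.toReal ^ r) := by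
    intro x r hr hx
    rw [← ENNReal.ofReal_rpow_of_nonneg toReal_nonneg hr, ofReal_toReal hx]
  have L1 := lintegral_rpow_eq_lintegral_meas_lt_mul volume (f := fun s => (fwdMax φ s).toReal)
    (.of_forall fun _ => toReal_nonneg) (measurable_fwdMax hφ).ennreal_toReal.aemeasurable
    (by linarith : 0 < q)
  have L2 := lintegral_rpow_eq_lintegral_meas_lt_mul ν (f := fun s => 2 * (φ s).toReal)
    (.of_forall fun _ => by positivity) (by fun_prop) hq1
  have weak : ∀ l : ℝ, 0 < l → volume {s | l < (fwdMax φ s).toReal} ≤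
      ENNReal.ofReal (20 / l) * ν {s | l < 2 * (φ s).toReal} := by
    intro l hl
    set B := {s | l < 2 * (φ s).toReal}
    have hB : MeasurableSet B := measurableSet_lt (by fun_prop) (by fun_prop)
    have hsub : {s | l < (fwdMax φ s).toReal} ⊆
        {s | ENNReal.ofReal (l / 2) < fwdMax (B.indicator φ) s} := by
      intro s hs
      have h1 : fwdMax φ s ≤ fwdMax (B.indicator φ) s + ENNReal.ofReal (l / 2) := by
        refine (fwdMax_mono (fun t => ?_) s).trans (fwdMax_add_const_le _ _)
        by_cases ht : t ∈ B
        · simp [ht]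
        · rw [Set.indicator_of_notMem ht, zero_add, ← ofReal_toReal (fin t)]
          refine ofReal_le_ofReal ?_
          have : 2 * (φ t).toReal ≤ l := not_lt.1 ht
          linarith
      have h2 : ENNReal.ofReal l < fwdMax φ s := (ofReal_lt_iff_lt_toReal hl.le (finm s)).2 hs
      by_contra h3
      have h3 : fwdMax (B.indicator φ) s ≤ ENNReal.ofReal (l / 2) := not_lt.1 h3
      have := h2.trans_le (h1.trans (add_le_add_left h3 _))
      rw [← ofReal_add (by positivity) (by positivity), add_halves] at this
      exact lt_irrefl _ this
    refine (measure_mono hsub).trans ?_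
    have := mul_meas_fwdMax_le (B.indicator φ) (c := ENNReal.ofReal (l / 2)) (by simpa)
      ofReal_ne_top
    rw [lintegral_indicator hB, ← withDensity_apply _ hB, mul_comm,
      ← ENNReal.le_div_iff_mul_le (by simp [hl]) (by simp)] at this
    refine this.trans (le_of_eq ?_)
    rw [div_eq_mul_inv, ← ofReal_inv_of_pos (by positivity), mul_right_comm,
      show (10 : ℝ≥0∞) = ENNReal.ofReal 10 by norm_num, ← ofReal_mul (by norm_num)]
    congr 2
    field_simp
    norm_num
  calc ∫⁻ s, fwdMax φ s ^ q = ∫⁻ s, ENNReal.ofReal ((fwdMax φ s).toReal ^ q) :=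
        lintegral_congr fun s => e1 (by linarith) (finm s)
    _ ≤ ENNReal.ofReal q * ∫⁻ l in Set.Ioi 0, ENNReal.ofReal 20 *
          (ν {s | l < 2 * (φ s).toReal} * ENNReal.ofReal (l ^ (q - 1 - 1))) := by
        rw [L1]
        refine mul_le_mul_right (setLIntegral_mono' measurableSet_Ioi fun l hl => ?_) _
        have hl : 0 < l := hl
        refine (mul_le_mul_left (weak l hl) _).trans (le_of_eq ?_)
        rw [Real.rpow_sub_one hl.ne' (q - 1), div_eq_mul_inv, ofReal_mul (by norm_num),
          div_eq_mul_inv, ofReal_mul (by positivity)]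
        ring
    _ = ENNReal.ofReal (20 * q / (q - 1)) * (ENNReal.ofReal (q - 1) * ∫⁻ l in Set.Ioi 0,
          ν {s | l < 2 * (φ s).toReal} * ENNReal.ofReal (l ^ (q - 1 - 1))) := by
        rw [lintegral_const_mul' _ _ ofReal_ne_top, ← mul_assoc, ← mul_assoc,
          ← ofReal_mul (by linarith), ← ofReal_mul (by positivity)]
        congr 2
        field_simp
    _ = ENNReal.ofReal (20 * q / (q - 1) * 2 ^ (q - 1)) * ∫⁻ t, φ t ^ q := by
        rw [← L2, lintegral_withDensity_eq_lintegral_mul _ hφ (by fun_prop),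
          ofReal_mul (by positivity), mul_assoc,
          ← lintegral_const_mul (ENNReal.ofReal (2 ^ (q - 1))) (by fun_prop)]
        congr 1
        refine lintegral_congr fun t => ?_
        rw [Pi.mul_apply, Real.mul_rpow (by norm_num) toReal_nonneg, ofReal_mul (by positivity),
          ← e1 hq1.le (fin t), mul_left_comm]
        congr 1
        simpa using (ENNReal.rpow_add_of_nonneg (x := φ t) _ _ zero_le_one hq1.le).symm

end Maximal

section Majorant

variable {d : ℕ} {t M : ℝ} {V : Type*} [NormedAddCommGroup V] [InnerProductSpace ℝ V]
  [CompleteSpace V]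

local notation "E" => EuclideanSpace ℝ (Fin d)

/-- The coefficient of the `k`-th dyadic block in the gradient majorant. -/
noncomputable def gradCoeff (d : ℕ) (k : ℤ) : ℝ :=
  d * (heatLip d ^ 2 / (2 * 2 ^ k)) * 8 ^ ((d : ℝ) / 2)

/-- The heat average of variances on the `k`-th dyadic block. -/
noncomputable def gradBlock (d : ℕ) {V : Type*} [NormedAddCommGroup V] [NormedSpace ℝ V]
    [CompleteSpace V] (h : EuclideanSpace ℝ (Fin d) → V) (k : ℤ) :
    EuclideanSpace ℝ (Fin d) → ℝ≥0∞ :=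
  heatAvg d (8 * 2 ^ k) (heatVar d (4 * 2 ^ k) (heatOp d (4 * 2 ^ k) h))

/-- A pointwise majorant of `‖∇ T_r h (x)‖²`, piecewise constant in `r`. -/
noncomputable def gradMajorant (d : ℕ) {V : Type*} [NormedAddCommGroup V] [NormedSpace ℝ V]
    [CompleteSpace V] (h : EuclideanSpace ℝ (Fin d) → V) (r : ℝ)
    (x : EuclideanSpace ℝ (Fin d)) : ℝ≥0∞ :=
  ∑' k : ℤ, (Set.Ioc (7 * 2 ^ k : ℝ) (14 * 2 ^ k)).indicator 1 r *
    (ENNReal.ofReal (gradCoeff d k) * gradBlock d h k x)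

theorem gradCoeff_nonneg (k : ℤ) : 0 ≤ gradCoeff d k := by unfold gradCoeff; positivity

theorem measurable_gradBlock_prod {α : Type*} [MeasurableSpace α] {h : α → E → V}
    (hh : StronglyMeasurable (Function.uncurry h)) (k : ℤ) :
    Measurable fun q : α × E => gradBlock d (h q.1) k q.2 :=
  measurable_heatAvg_prod (g := fun a => heatVar d (4 * 2 ^ k) (heatOp d (4 * 2 ^ k) (h a)))
    (measurable_heatVar_prod (h := fun a => heatOp d (4 * 2 ^ k) (h a))
      (stronglyMeasurable_heatOp_prod hh))

theorem measurable_gradMajorant_prod {α : Type*} [MeasurableSpace α] {h : α → E → V}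
    (hh : StronglyMeasurable (Function.uncurry h)) :
    Measurable fun q : α × ℝ × E => gradMajorant d (h q.1) q.2.1 q.2.2 := by
  unfold gradMajorant
  refine Measurable.tsum fun k => Measurable.mul ?_ (Measurable.const_mul ?_ _)
  · exact (measurable_one.indicator measurableSet_Ioc).comp (measurable_fst.comp measurable_snd)
  · exact (measurable_gradBlock_prod hh k).comp
      (f := fun q : α × ℝ × E => (q.1, q.2.2)) (by fun_prop)

theorem ofReal_gradHeatNormSq_le_gradMajorant {h : E → V} (hh : BddMeas h) {r : ℝ} (hr : 0 < r)
    (x : E) : ENNReal.ofReal (gradHeatNormSq d r h x) ≤ gradMajorant d h r x := by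
  obtain ⟨k, hk1, hk2⟩ : ∃ k : ℤ, (7 : ℝ) * 2 ^ k < r ∧ r ≤ 14 * 2 ^ k := by
    obtain ⟨k, h1, h2⟩ := exists_mem_Ioc_zpow (x := r / 7) (y := 2) (by positivity) (by norm_num)
    rw [zpow_add_one₀ two_ne_zero] at h2
    exact ⟨k, by linarith, by linarith⟩
  have hk0 : (0 : ℝ) < 2 ^ k := by positivity
  have ha : (2 : ℝ) ^ k < r - 6 * 2 ^ k := by linarith
  have hm : Measurable (heatVar d (4 * 2 ^ k) (heatOp d (4 * 2 ^ k) h)) :=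
    measurable_heatVar (stronglyMeasurable_heatOp hh.meas)
  have h1 := ofReal_gradHeatNormSq_le (hk0.trans ha) (b := 2 * 2 ^ k) (c := 4 * 2 ^ k)
    (by positivity) (by positivity) hh x
  rw [show r - 6 * 2 ^ k + (2 * 2 ^ k + 4 * 2 ^ k) = r by ring,
    show (2 : ℝ) * (2 * 2 ^ k) = 4 * 2 ^ k by ring] at h1
  calc _ ≤ _ := h1
    _ ≤ ENNReal.ofReal (d * (heatLip d ^ 2 / (2 * 2 ^ k))) *
          (ENNReal.ofReal (8 ^ ((d : ℝ) / 2)) * gradBlock d h k x) := by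
        gcongr
        refine (heatAvg_le_heatAvg (t := 8 * 2 ^ k) (hk0.trans ha) (by linarith) hm x).trans ?_
        unfold gradBlock
        gcongr
        · exact div_nonneg (by positivity) (by linarith)
        · rw [div_le_iff₀ (by linarith)]
          linarith
    _ = (Set.Ioc (7 * 2 ^ k : ℝ) (14 * 2 ^ k)).indicator 1 r *
          (ENNReal.ofReal (gradCoeff d k) * gradBlock d h k x) := by
        rw [Set.indicator_of_mem (show r ∈ Set.Ioc (7 * 2 ^ k : ℝ) (14 * 2 ^ k) from ⟨hk1, hk2⟩),
          Pi.one_apply, one_mul, gradCoeff,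
          ofReal_mul (p := d * (heatLip d ^ 2 / (2 * 2 ^ k))) (by positivity), mul_assoc]
    _ ≤ _ := ENNReal.le_tsum k

theorem heatAvg_ofReal (ht : 0 < t) {m : E → ℝ} (hm : BddMeas m) (hm0 : ∀ x, 0 ≤ m x) (x : E) :
    heatAvg d t (fun y => ENNReal.ofReal (m y)) x = ENNReal.ofReal (heatOp d t m x) := by
  have := isProbabilityMeasure_heatMeasure (d := d) ht
  rw [heatOp_eq ht, ofReal_integral_eq_lintegral_ofReal (hm.comp_sub x).integrable
    (.of_forall fun _ => hm0 _), heatAvg]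

/-- The constant in the weighted estimate. -/
noncomputable def squareConst (d : ℕ) : ℝ := 7 * (d * heatLip d ^ 2) * 8 ^ ((d : ℝ) / 2)

theorem squareConst_nonneg : 0 ≤ squareConst d := by unfold squareConst; positivity

theorem lintegral_gradMajorant_mul_le {F : ℝ → ℝ → ℝ≥0∞} (hF : IsBellman M F) {h : E → V}
    (hh : BddMeas h) {m : E → ℝ} (hm : BddMeas m) (hm0 : ∀ x, 0 ≤ m x) (hmM : ∀ x, m x ≤ M)
    {φ : ℝ → E → ℝ≥0∞} (hφ : Measurable (Function.uncurry φ))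
    (hφm : ∀ x (k : ℤ), ∫⁻ r in Set.Ioc 0 (14 * 2 ^ k), φ r x ≤
      ENNReal.ofReal (14 * 2 ^ k) * ENNReal.ofReal (m x)) :
    ∫⁻ x, ∫⁻ r in Set.Ioi 0, gradMajorant d h r x * φ r x ≤
      ENNReal.ofReal (squareConst d) * ∫⁻ x, F (‖h x‖ ^ 2) (m x) := by
  have hφx : ∀ x, Measurable fun r => φ r x := fun x =>
    hφ.comp (f := fun r => (r, x)) (by fun_prop)
  have hvar : ∀ k : ℤ, Measurable (heatVar d (4 * 2 ^ k) (heatOp d (4 * 2 ^ k) h)) :=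
    fun k => measurable_heatVar (stronglyMeasurable_heatOp hh.meas)
  have hblock : ∀ k, Measurable (gradBlock d h k) := fun k => measurable_heatAvg (hvar k)
  have hmm : Measurable m := hm.meas.measurable
  have hx : ∀ x, ∫⁻ r in Set.Ioi 0, gradMajorant d h r x * φ r x ≤
      ∑' k : ℤ, ENNReal.ofReal (squareConst d) * (gradBlock d h k x * ENNReal.ofReal (m x)) := by
    intro x
    simp_rw [gradMajorant, ← ENNReal.tsum_mul_right]
    rw [lintegral_tsum (f := fun (k : ℤ) r => (Set.Ioc (7 * 2 ^ k : ℝ) (14 * 2 ^ k)).indicator 1 r *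
      (ENNReal.ofReal (gradCoeff d k) * gradBlock d h k x) * φ r x) fun k =>
      (((measurable_one.indicator measurableSet_Ioc).mul_const _).mul (hφx x)).aemeasurable]
    refine ENNReal.tsum_le_tsum fun k => ?_
    have hk : (0 : ℝ) < 7 * 2 ^ k := by positivity
    calc _ ≤ ∫⁻ r, (Set.Ioc (0 : ℝ) (14 * 2 ^ k)).indicator
            (fun r => ENNReal.ofReal (gradCoeff d k) * gradBlock d h k x * φ r x) r := by
          refine (setLIntegral_le_lintegral _ _).trans (lintegral_mono fun r => ?_)
          by_cases hr : r ∈ Set.Ioc (7 * 2 ^ k : ℝ) (14 * 2 ^ k)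
          · have : r ∈ Set.Ioc (0 : ℝ) (14 * 2 ^ k) := ⟨hk.trans hr.1, hr.2⟩
            simp [hr, this]
          · simp [hr]
      _ = ENNReal.ofReal (gradCoeff d k) * gradBlock d h k x *
            ∫⁻ r in Set.Ioc (0 : ℝ) (14 * 2 ^ k), φ r x := by
          rw [lintegral_indicator measurableSet_Ioc, lintegral_const_mul _ (hφx x)]
      _ ≤ ENNReal.ofReal (gradCoeff d k) * gradBlock d h k x *
            (ENNReal.ofReal (14 * 2 ^ k) * ENNReal.ofReal (m x)) := by
          gcongr
          exact hφm x k
      _ = ENNReal.ofReal (gradCoeff d k) * ENNReal.ofReal (14 * 2 ^ k) *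
            (gradBlock d h k x * ENNReal.ofReal (m x)) := by ring
      _ = _ := by
          rw [← ofReal_mul (gradCoeff_nonneg k), gradCoeff, squareConst]
          congr 2
          field_simp
          ring
  calc _ ≤ ∫⁻ x, ∑' k : ℤ, ENNReal.ofReal (squareConst d) *
          (gradBlock d h k x * ENNReal.ofReal (m x)) := lintegral_mono hx
    _ = ENNReal.ofReal (squareConst d) *
          ∑' k : ℤ, ∫⁻ x, gradBlock d h k x * ENNReal.ofReal (m x) := by
        rw [lintegral_tsum (f := fun (k : ℤ) x => ENNReal.ofReal (squareConst d) *
            (gradBlock d h k x * ENNReal.ofReal (m x)))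
            fun k => (((hblock k).mul hmm.ennreal_ofReal).const_mul _).aemeasurable,
          ← ENNReal.tsum_mul_left]
        exact tsum_congr fun k => lintegral_const_mul _ ((hblock k).mul hmm.ennreal_ofReal)
    _ ≤ _ := by
        gcongr
        refine le_trans (le_of_eq (tsum_congr fun k => ?_)) (hF.sum_le hh hm hm0 hmM)
        rw [gradBlock, lintegral_heatAvg_mul (hvar k) hmm.ennreal_ofReal]
        exact lintegral_congr fun x => by rw [heatAvg_ofReal (by positivity) hm hm0]

theorem lintegral_gradMajorant_le {h : E → V} (hh : BddMeas h) :
    ∫⁻ x, ∫⁻ r in Set.Ioi 0, gradMajorant d h r x ≤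
      ENNReal.ofReal (squareConst d) * ∫⁻ x, ENNReal.ofReal (‖h x‖ ^ 2) := by
  simpa using lintegral_gradMajorant_mul_le isBellman_ofReal hh (m := fun _ => 1)
    ⟨stronglyMeasurable_const, 1, by simp⟩ (by simp) (by simp) (φ := fun _ _ => 1)
    measurable_const (by simp)

theorem le_two_mul_rpow_mul_rpow {κ q L K X Y : ℝ} (hq : κ.HolderConjugate q) (hK : 0 ≤ K)
    (hX : 0 ≤ X) (hY : 0 ≤ Y) (h : ∀ l : ℝ, 0 < l → l * L ≤ K * (X + l ^ q * Y)) :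
    L ≤ 2 * K * (X ^ (1 / κ) * Y ^ (1 / q)) := by
  have hq0 := hq.symm.pos
  have pos : ∀ ε : ℝ, 0 < ε → L ≤ 2 * K * ((X + ε) ^ (1 / κ) * (Y + ε) ^ (1 / q)) := by
    intro ε hε
    have hX' : 0 < X + ε := by linarith
    have hY' : 0 < Y + ε := by linarith
    have h1 := h (((X + ε) / (Y + ε)) ^ (1 / q)) (by positivity)
    rw [← Real.rpow_mul (by positivity), one_div_mul_cancel hq0.ne', Real.rpow_one] at h1
    have h2 : (X + ε) / (Y + ε) * Y ≤ X + ε := by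
      rw [div_mul_eq_mul_div, div_le_iff₀ hY']
      nlinarith
    have h3 : ((X + ε) / (Y + ε)) ^ (1 / q) * L ≤ 2 * K * (X + ε) :=
      h1.trans (by nlinarith)
    have e : 2 * K * (X + ε) =
        ((X + ε) / (Y + ε)) ^ (1 / q) * (2 * K * ((X + ε) ^ (1 / κ) * (Y + ε) ^ (1 / q))) := by
      have : (X + ε) ^ (1 / q) * (X + ε) ^ (1 / κ) = X + ε := by
        rw [← Real.rpow_add hX', one_div, one_div, hq.symm.inv_add_inv_eq_one, Real.rpow_one]
      rw [Real.div_rpow hX'.le hY'.le]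
      field_simp
      linear_combination (-K) * this
    rw [e] at h3
    exact le_of_mul_le_mul_left h3 (by positivity)
  have hc : Continuous fun ε : ℝ => 2 * K * ((X + ε) ^ (1 / κ) * (Y + ε) ^ (1 / q)) := by
    refine continuous_const.mul (Continuous.mul ?_ ?_)
    · exact (continuous_const.add continuous_id).rpow_const fun _ => .inr hq.one_div_nonneg
    · exact (continuous_const.add continuous_id).rpow_const fun _ => .inr hq.symm.one_div_nonneg
  have := (hc.tendsto 0).mono_left (nhdsWithin_le_nhds (s := Set.Ioi 0))
  simp only [add_zero] at this
  exact ge_of_tendsto this (eventually_nhdsWithin_of_forall fun ε hε => pos ε hε)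

theorem lintegral_gradMajorant_mul_le_rpow {κ q C : ℝ} (hq : κ.HolderConjugate q) (hC0 : 0 ≤ C)
    (hC : ∀ n φ : ℝ, 0 ≤ n → 0 ≤ φ → bellman q n φ ≤ ENNReal.ofReal (C * (n ^ κ + φ ^ q)))
    {h : E → V} (hh : BddMeas h) (hhX : ∫⁻ x, ENNReal.ofReal (‖h x‖ ^ (2 * κ)) ≠ ∞)
    {m : E → ℝ} (hm : BddMeas m) (hm0 : ∀ x, 0 ≤ m x)
    (hmY : ∫⁻ x, ENNReal.ofReal (m x) ^ q ≠ ∞)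
    {φ : ℝ → E → ℝ≥0∞} (hφ : Measurable (Function.uncurry φ))
    (hφm : ∀ x (k : ℤ), ∫⁻ r in Set.Ioc 0 (14 * 2 ^ k), φ r x ≤
      ENNReal.ofReal (14 * 2 ^ k) * ENNReal.ofReal (m x)) :
    ∫⁻ x, ∫⁻ r in Set.Ioi 0, gradMajorant d h r x * φ r x ≤
      ENNReal.ofReal (2 * (squareConst d * C)) *
        ((∫⁻ x, ENNReal.ofReal (‖h x‖ ^ (2 * κ))) ^ (1 / κ) *
          (∫⁻ x, ENNReal.ofReal (m x) ^ q) ^ (1 / q)) := by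
  have hq0 := hq.symm.pos
  set X := ∫⁻ x, ENNReal.ofReal (‖h x‖ ^ (2 * κ)) with hX
  set Y := ∫⁻ x, ENNReal.ofReal (m x) ^ q with hY
  set L := ∫⁻ x, ∫⁻ r in Set.Ioi 0, gradMajorant d h r x * φ r x with hL
  have hmm : Measurable m := hm.meas.measurable
  have hsc := squareConst_nonneg (d := d)
  have scaled : ∀ l : ℝ, 0 < l → ENNReal.ofReal l * L ≤
      ENNReal.ofReal (squareConst d * C) * (X + ENNReal.ofReal (l ^ q) * Y) := by
    intro l hl
    obtain ⟨M, hM⟩ := hm.bdd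
    have := lintegral_gradMajorant_mul_le (M := l * M) (isBellman_bellman hq) hh
      (m := fun x => l * m x)
      ⟨hm.meas.const_mul l, l * M, fun x => by
        rw [norm_mul, Real.norm_of_nonneg hl.le]; gcongr; exact hM x⟩
      (fun x => mul_nonneg hl.le (hm0 x))
      (fun x => by gcongr; exact (le_abs_self _).trans (hM x))
      (φ := fun r x => ENNReal.ofReal l * φ r x) (hφ.const_mul _) (fun x k => by
        rw [lintegral_const_mul' _ _ ofReal_ne_top, ofReal_mul hl.le, mul_left_comm]
        gcongr
        exact hφm x k)
    simp_rw [mul_left_comm _ (ENNReal.ofReal l), lintegral_const_mul' (ENNReal.ofReal l) _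
      ofReal_ne_top] at this
    refine this.trans ?_
    rw [ofReal_mul hsc, mul_assoc]
    gcongr
    rw [hX, hY, ← lintegral_const_mul _ (by fun_prop), ← lintegral_add_right _ (by fun_prop),
      ← lintegral_const_mul' _ _ ofReal_ne_top]
    refine lintegral_mono fun x => (hC _ _ (by positivity) (mul_nonneg hl.le (hm0 x))).trans ?_
    have := hm0 x
    rw [ofReal_mul hC0, ofReal_add (by positivity) (by positivity), Real.mul_rpow hl.le (hm0 x),
      ofReal_mul (by positivity), ofReal_rpow_of_nonneg (hm0 x) hq0.le, ← Real.rpow_natCast,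
      ← Real.rpow_mul (by positivity)]
    simp
  have hLtop : L ≠ ∞ := by
    have := scaled 1 one_pos
    simp only [ofReal_one, one_mul, Real.one_rpow] at this
    exact (this.trans_lt (mul_lt_top ofReal_lt_top (add_lt_top.2 ⟨hhX.lt_top, hmY.lt_top⟩))).ne
  have real := le_two_mul_rpow_mul_rpow (L := L.toReal) (X := X.toReal) (Y := Y.toReal) hq
    (mul_nonneg hsc hC0) toReal_nonneg toReal_nonneg (fun l hl => by
      have := scaled l hl
      rw [← ofReal_toReal hLtop, ← ofReal_toReal hhX, ← ofReal_toReal hmY, ← ofReal_mul hl.le,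
        ← ofReal_mul (by positivity), ← ofReal_add (by positivity) (by positivity),
        ← ofReal_mul (by positivity), ofReal_le_ofReal_iff (by positivity)] at this
      exact this)
  rw [← ofReal_toReal hLtop, ← ofReal_toReal hhX, ← ofReal_toReal hmY,
    ofReal_rpow_of_nonneg toReal_nonneg hq.one_div_nonneg,
    ofReal_rpow_of_nonneg toReal_nonneg hq.symm.one_div_nonneg, ← ofReal_mul (by positivity),
    ← ofReal_mul (by positivity)]
  exact ofReal_le_ofReal real

end Majorant

section Holder

variable {α : Type*} [MeasurableSpace α] {μ : Measure α}

theorem rpow_lintegral_rpow_le {γ : ℝ} (hγ : 1 < γ) {Q c : α → ℝ≥0∞} (hQ : Measurable Q)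
    (hc : Measurable c) (hct : ∀ a, c a ≠ ∞) (hc0 : ∀ a, c a = 0 → Q a = 0) :
    (∫⁻ a, Q a ^ (1 / γ) ∂μ) ^ γ ≤
      (∫⁻ a, c a ^ (1 - γ) * Q a ∂μ) * (∫⁻ a, c a ∂μ) ^ (γ - 1) := by
  have hγ0 : 0 < γ := by linarith
  have split : ∀ a, Q a ^ (1 / γ) = (c a ^ (1 - γ) * Q a) ^ (1 / γ) * c a ^ ((γ - 1) / γ) := by
    intro a
    rcases eq_or_ne (c a) 0 with h | h
    · rw [hc0 a h, zero_rpow_of_pos (by positivity), mul_zero, zero_rpow_of_pos (by positivity),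
        zero_mul]
    · rw [mul_rpow_of_nonneg _ _ (by positivity), ← ENNReal.rpow_mul, mul_right_comm,
        ← ENNReal.rpow_add _ _ h (hct a), show (1 - γ) * (1 / γ) + (γ - 1) / γ = 0 by ring,
        ENNReal.rpow_zero, one_mul]
  have holder := ENNReal.lintegral_mul_norm_pow_le (μ := μ) (f := fun a => c a ^ (1 - γ) * Q a)
    (g := c) ((hc.pow_const _).mul hQ).aemeasurable hc.aemeasurable (p := 1 / γ)
    (q := (γ - 1) / γ) (by positivity) (div_nonneg (by linarith) hγ0.le) (by field_simp; ring)
  simp_rw [← split] at holder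
  calc _ ≤ _ := ENNReal.rpow_le_rpow holder hγ0.le
    _ = _ := by
      rw [mul_rpow_of_nonneg _ _ hγ0.le, ← ENNReal.rpow_mul, ← ENNReal.rpow_mul,
        one_div_mul_cancel hγ0.ne', div_mul_cancel₀ _ hγ0.ne', ENNReal.rpow_one]

/-- Testing a function against truncations of its own power bounds its `L^κ` norm. -/
theorem lintegral_rpow_le_of_forall_mul_le {κ q : ℝ} (hq : κ.HolderConjugate q) {Y : α → ℝ≥0∞}
    (hY : Measurable Y) {S : ℕ → Set α} (hS : ∀ n, MeasurableSet (S n)) (hSm : Monotone S)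
    (hSu : ∀ a, ∃ n, a ∈ S n) (hSt : ∀ n, μ (S n) ≠ ∞) {K : ℝ≥0∞}
    (h : ∀ (n : ℕ) (φ : α → ℝ≥0∞), Measurable φ → (∃ M ≠ ∞, ∀ a, φ a ≤ M) →
      (∀ a, a ∉ S n → φ a = 0) →
      ∫⁻ a, Y a * φ a ∂μ ≤ K * (∫⁻ a, φ a ^ q ∂μ) ^ (1 / q)) :
    ∫⁻ a, Y a ^ κ ∂μ ≤ K ^ κ := by
  have hκ := hq.pos
  have hκ1 : 0 < κ - 1 := hq.sub_one_pos
  have hq0 := hq.symm.pos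
  set u : ℕ → α → ℝ≥0∞ := fun n => (S n).indicator fun a => min (Y a) n with hu
  have hum : ∀ n, Measurable (u n) := fun n => (hY.min measurable_const).indicator (hS n)
  have hun : ∀ n a, u n a ≤ n := fun n a =>
    Set.indicator_apply_le' (fun _ => min_le_right _ _) fun _ => zero_le
  have huY : ∀ n a, u n a ≤ Y a := fun n a =>
    Set.indicator_apply_le' (fun _ => min_le_left _ _) fun _ => zero_le
  have bound : ∀ n, ∫⁻ a, u n a ^ κ ∂μ ≤ K ^ κ := by
    intro n
    set A := ∫⁻ a, u n a ^ κ ∂μ with hA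
    have hAt : A ≠ ∞ := by
      have : A ≤ ∫⁻ a, (S n).indicator (fun _ => (n : ℝ≥0∞) ^ κ) a ∂μ := by
        refine lintegral_mono fun a => ?_
        by_cases ha : a ∈ S n
        · simp only [ha, Set.indicator_of_mem]
          exact ENNReal.rpow_le_rpow (hun n a) hκ.le
        · simp [hu, ha, hκ]
      rw [lintegral_indicator_const (hS n)] at this
      exact (this.trans_lt (mul_lt_top (rpow_lt_top_of_nonneg hκ.le (natCast_ne_top n))
        (hSt n).lt_top)).ne
    have key := h n (fun a => u n a ^ (κ - 1)) ((hum n).pow_const _)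
      ⟨(n : ℝ≥0∞) ^ (κ - 1), (rpow_lt_top_of_nonneg hκ1.le (natCast_ne_top n)).ne,
        fun a => ENNReal.rpow_le_rpow (hun n a) hκ1.le⟩ fun a ha => by
        simp [hu, ha, hκ1]
    have e : ∀ a, (u n a ^ (κ - 1)) ^ q = u n a ^ κ := fun a => by
      rw [← ENNReal.rpow_mul, hq.sub_one_mul_conj]
    simp_rw [e] at key
    have low : A ≤ ∫⁻ a, Y a * u n a ^ (κ - 1) ∂μ := by
      refine lintegral_mono fun a => ?_
      calc u n a ^ κ = u n a * u n a ^ (κ - 1) := by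
            nth_rw 2 [← ENNReal.rpow_one (u n a)]
            rw [← ENNReal.rpow_add_of_nonneg _ _ zero_le_one hκ1.le]
            congr 1
            ring
        _ ≤ _ := by gcongr; exact huY n a
    have h2 : A ≤ K * A ^ (1 / q) := low.trans key
    rcases eq_or_ne A 0 with h0 | h0
    · rw [h0]; exact zero_le
    have h3 : A ^ (1 / κ) ≤ K := by
      have hpos : A ^ (1 / q) ≠ 0 := (rpow_pos (pos_iff_ne_zero.2 h0) hAt).ne'
      have htop : A ^ (1 / q) ≠ ∞ := (rpow_lt_top_of_nonneg hq.symm.one_div_nonneg hAt).ne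
      rw [← ENNReal.mul_le_mul_iff_left hpos htop, ← ENNReal.rpow_add _ _ h0 hAt, one_div,
        one_div, hq.inv_add_inv_eq_one, ENNReal.rpow_one]
      simpa using h2
    calc A = (A ^ (1 / κ)) ^ κ := by
          rw [← ENNReal.rpow_mul, one_div_mul_cancel hκ.ne', ENNReal.rpow_one]
      _ ≤ K ^ κ := ENNReal.rpow_le_rpow h3 hκ.le
  have hmono : ∀ a, Monotone fun n => u n a ^ κ := fun a i j hij => by
    refine ENNReal.rpow_le_rpow ?_ hκ.le
    refine Set.indicator_apply_le' (fun ha => ?_) fun _ => zero_le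
    rw [hu]
    simp only [hSm hij ha, Set.indicator_of_mem]
    gcongr
  have hsup : ∀ a, ⨆ n, u n a ^ κ = Y a ^ κ := by
    intro a
    refine le_antisymm (iSup_le fun n => ENNReal.rpow_le_rpow (huY n a) hκ.le) ?_
    obtain ⟨N, hN⟩ := hSu a
    have h1 : Filter.Tendsto (fun n : ℕ => min (Y a) (n : ℝ≥0∞)) Filter.atTop (nhds (Y a)) := by
      simpa using tendsto_const_nhds (x := Y a) |>.min ENNReal.tendsto_nat_nhds_top
    have h2 : Filter.Tendsto (fun n => u n a) Filter.atTop (nhds (Y a)) := by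
      refine h1.congr' ?_
      filter_upwards [Filter.eventually_ge_atTop N] with n hn
      simp [hu, hSm hn hN]
    exact le_of_tendsto' ((ENNReal.continuous_rpow_const.tendsto _).comp h2) fun n =>
      le_iSup (fun n => u n a ^ κ) n
  calc _ = ∫⁻ a, ⨆ n, u n a ^ κ ∂μ := by simp_rw [hsup]
    _ = ⨆ n, ∫⁻ a, u n a ^ κ ∂μ :=
      lintegral_iSup (fun n => (hum n).pow_const _) fun i j hij a => hmono a hij
    _ ≤ _ := iSup_le bound

end Holder

section Assembly

variable {d : ℕ} {V : Type*} [NormedAddCommGroup V] [InnerProductSpace ℝ V] [CompleteSpace V]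

local notation "E" => EuclideanSpace ℝ (Fin d)

/-- The causal superposition of gradient majorants of a family `h` started at the times `a.1`,
with weight `w`. -/
noncomputable def causalMajorant (d : ℕ) {V : Type*} [NormedAddCommGroup V] [NormedSpace ℝ V]
    [CompleteSpace V] (μ : Measure (ℝ × ℝ)) (w : ℝ × ℝ → ℝ≥0∞)
    (h : ℝ × ℝ → EuclideanSpace ℝ (Fin d) → V) (z : ℝ × EuclideanSpace ℝ (Fin d)) : ℝ≥0∞ :=
  ∫⁻ a, w a * (Set.Ioi 0).indicator (fun r => gradMajorant d (h a) r z.2) (z.1 - a.1) ∂μ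

variable {μ : Measure (ℝ × ℝ)} [SFinite μ] {w : ℝ × ℝ → ℝ≥0∞} 
  {h : ℝ × ℝ → EuclideanSpace ℝ (Fin d) → V}

theorem measurable_indicator_gradMajorant (hh : StronglyMeasurable (Function.uncurry h)) :
    Measurable fun q : (ℝ × ℝ) × ℝ × E =>
      (Set.Ioi (0 : ℝ)).indicator (fun r => gradMajorant d (h q.1) r q.2.2) (q.2.1 - q.1.1) := by
  have hs : MeasurableSet {q : (ℝ × ℝ) × ℝ × E | q.2.1 - q.1.1 ∈ Set.Ioi (0 : ℝ)} :=
    measurableSet_Ioi.preimage (f := fun q : (ℝ × ℝ) × ℝ × E => q.2.1 - q.1.1) (by fun_prop)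
  have := ((measurable_gradMajorant_prod hh).comp
    (f := fun q : (ℝ × ℝ) × ℝ × E => (q.1, q.2.1 - q.1.1, q.2.2)) (by fun_prop)).indicator hs
  exact this

theorem measurable_causalMajorant (hh : StronglyMeasurable (Function.uncurry h))
    (hw : Measurable w) : Measurable (causalMajorant d μ w h) := by
  unfold causalMajorant
  refine Measurable.lintegral_prod_right' (f := fun q : (ℝ × E) × ℝ × ℝ => w q.2 *
    (Set.Ioi 0).indicator (fun r => gradMajorant d (h q.2) r q.1.2) (q.1.1 - q.2.1)) ?_
  exact (hw.comp measurable_snd).mul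
    ((measurable_indicator_gradMajorant hh).comp measurable_swap)

theorem lintegral_causalMajorant_mul (hh : StronglyMeasurable (Function.uncurry h))
    (hw : Measurable w) {φ : ℝ × E → ℝ≥0∞} (hφ : Measurable φ) :
    ∫⁻ z, causalMajorant d μ w h z * φ z = ∫⁻ a, w a *
      (∫⁻ x, ∫⁻ r in Set.Ioi 0, gradMajorant d (h a) r x * φ (a.1 + r, x)) ∂μ := by
  have hQ := measurable_indicator_gradMajorant hh
  have hQa : ∀ a, Measurable fun z : ℝ × E =>
      (Set.Ioi (0 : ℝ)).indicator (fun r => gradMajorant d (h a) r z.2) (z.1 - a.1) :=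
    fun a => hQ.comp (f := fun z => (a, z)) (by fun_prop)
  have hQz : ∀ z : ℝ × E, Measurable fun a : ℝ × ℝ =>
      (Set.Ioi (0 : ℝ)).indicator (fun r => gradMajorant d (h a) r z.2) (z.1 - a.1) :=
    fun z => hQ.comp (f := fun a => (a, z)) (by fun_prop)
  calc _ = ∫⁻ z, ∫⁻ a, w a * (Set.Ioi (0 : ℝ)).indicator
          (fun r => gradMajorant d (h a) r z.2) (z.1 - a.1) * φ z ∂μ :=
        lintegral_congr fun z => (lintegral_mul_const _ (hw.mul (hQz z))).symm
    _ = ∫⁻ a, (∫⁻ z, w a * (Set.Ioi (0 : ℝ)).indicator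
          (fun r => gradMajorant d (h a) r z.2) (z.1 - a.1) * φ z) ∂μ := by
        refine lintegral_lintegral_swap (f := fun (z : ℝ × E) (a : ℝ × ℝ) => w a *
          (Set.Ioi (0 : ℝ)).indicator (fun r => gradMajorant d (h a) r z.2) (z.1 - a.1) * φ z) ?_
        exact (((hw.comp measurable_snd).mul (hQ.comp measurable_swap)).mul
          (hφ.comp measurable_fst)).aemeasurable
    _ = _ := by
        refine lintegral_congr fun a => ?_
        simp_rw [mul_assoc]
        have hm : Measurable fun z : ℝ × E => (Set.Ioi (0 : ℝ)).indicator
          (fun r => gradMajorant d (h a) r z.2) (z.1 - a.1) * φ z := (hQa a).mul hφ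
        rw [lintegral_const_mul _ hm, Measure.volume_eq_prod, lintegral_prod_symm _ hm.aemeasurable]
        congr 1
        refine lintegral_congr fun x => ?_
        rw [← lintegral_indicator measurableSet_Ioi,
          ← lintegral_add_left_eq_self _ a.1]
        refine lintegral_congr fun r => ?_
        simp only [add_sub_cancel_left]
        by_cases hr : r ∈ Set.Ioi (0 : ℝ) <;> simp [hr]

variable {σ τ : Measure ℝ} [SFinite σ] [SFinite τ] {c : ℝ × ℝ → ℝ≥0∞} {γ : ℝ}

/-- The weight produced by Hölder's inequality in the second variable. -/
noncomputable def holderWeight (τ : Measure ℝ) (γ : ℝ) (c : ℝ × ℝ → ℝ≥0∞) (a : ℝ × ℝ) : ℝ≥0∞ :=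
  (∫⁻ θ, c (a.1, θ) ∂τ) ^ (γ - 1) * c a ^ (1 - γ)

theorem measurable_holderWeight (hc : Measurable c) : Measurable (holderWeight τ γ c) := by
  unfold holderWeight
  exact ((hc.lintegral_prod_right'.comp measurable_fst).pow_const _).mul (hc.pow_const _)

theorem lintegral_causalMajorant_mul_le (hγ : 1 < γ)
    (hh : StronglyMeasurable (Function.uncurry h)) (hc : Measurable c) (hct : ∀ a, c a ≠ ∞)
    {φ : ℝ × E → ℝ≥0∞} (hφ : Measurable φ) {B : ℝ → ℝ≥0∞} (hB : Measurable B)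
    (hle : ∀ a, ∫⁻ x, ∫⁻ r in Set.Ioi 0, gradMajorant d (h a) r x * φ (a.1 + r, x) ≤
      c a ^ γ * B a.1) :
    ∫⁻ z, causalMajorant d (σ.prod τ) (holderWeight τ γ c) h z * φ z ≤
      ∫⁻ s, (∫⁻ θ, c (s, θ) ∂τ) ^ γ * B s ∂σ := by
  have hC : Measurable fun s => ∫⁻ θ, c (s, θ) ∂τ := hc.lintegral_prod_right'
  rw [lintegral_causalMajorant_mul hh (measurable_holderWeight hc) hφ]
  have hpt : ∀ a, holderWeight τ γ c a *
      ∫⁻ x, ∫⁻ r in Set.Ioi 0, gradMajorant d (h a) r x * φ (a.1 + r, x) ≤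
      (∫⁻ θ, c (a.1, θ) ∂τ) ^ (γ - 1) * B a.1 * c a := by
    intro a
    refine (mul_le_mul_right (hle a) _).trans ?_
    have : c a ^ (1 - γ) * c a ^ γ ≤ c a := by
      rcases eq_or_ne (c a) 0 with h0 | h0
      · rw [h0, zero_rpow_of_pos (by linarith : 0 < γ), mul_zero]
      · rw [← ENNReal.rpow_add _ _ h0 (hct a), sub_add_cancel, ENNReal.rpow_one]
    calc _ = (∫⁻ θ, c (a.1, θ) ∂τ) ^ (γ - 1) * B a.1 * (c a ^ (1 - γ) * c a ^ γ) := by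
          rw [holderWeight]; ring
      _ ≤ _ := by gcongr
  refine (lintegral_mono hpt).trans ?_
  have hm : Measurable fun a : ℝ × ℝ => (∫⁻ θ, c (a.1, θ) ∂τ) ^ (γ - 1) * B a.1 * c a :=
    (((hC.pow_const _).mul hB).comp measurable_fst).mul hc
  rw [lintegral_prod _ hm.aemeasurable]
  refine lintegral_mono fun s => ?_
  simp only
  rw [lintegral_const_mul _ (f := fun y => c (s, y)) (hc.comp measurable_prodMk_left)]
  refine le_of_eq ?_
  calc _ = (∫⁻ θ, c (s, θ) ∂τ) ^ (γ - 1) * (∫⁻ θ, c (s, θ) ∂τ) ^ (1 : ℝ) * B s := by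
        rw [ENNReal.rpow_one]; ring
    _ = _ := by
        rw [← ENNReal.rpow_add_of_nonneg _ _ (by linarith) zero_le_one, sub_add_cancel]

/-- The constant in the dual estimate for the causal superposition. -/
noncomputable def dualConst (d : ℕ) (q C : ℝ) : ℝ :=
  2 * (squareConst d * C) * (20 * q / (q - 1) * 2 ^ (q - 1)) ^ (1 / q)

theorem lintegral_causalMajorant_mul_le_rpow {κ q C : ℝ} (hq : κ.HolderConjugate q) (hC0 : 0 ≤ C)
    (hC : ∀ n φ : ℝ, 0 ≤ n → 0 ≤ φ → bellman q n φ ≤ ENNReal.ofReal (C * (n ^ κ + φ ^ q)))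
    (hσ : σ ≤ volume) (hγ : 1 < γ) (hh : StronglyMeasurable (Function.uncurry h))
    (hhb : ∀ a, BddMeas (h a)) (hc : Measurable c) (hct : ∀ a, c a ≠ ∞)
    (hch : ∀ a, c a ^ γ = (∫⁻ x, ENNReal.ofReal (‖h a x‖ ^ (2 * κ))) ^ (1 / κ))
    {φ : ℝ × E → ℝ≥0∞} (hφ : Measurable φ) (hφM : ∃ M ≠ ∞, ∀ z, φ z ≤ M)
    {R : ℝ} (hφR : ∀ z, z ∉ Metric.closedBall 0 R → φ z = 0) :
    ∫⁻ z, causalMajorant d (σ.prod τ) (holderWeight τ γ c) h z * φ z ≤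
      ENNReal.ofReal (dualConst d q C) * (∫⁻ s, (∫⁻ θ, c (s, θ) ∂τ) ^ (γ * κ) ∂σ) ^ (1 / κ) *
        (∫⁻ z, φ z ^ q) ^ (1 / q) := by
  obtain ⟨M, hM, hφM⟩ := hφM
  have hκ := hq.pos
  have hq0 := hq.symm.pos
  have hq1 := hq.symm.lt
  set m : ℝ → E → ℝ≥0∞ := fun s x => fwdMax (fun t => φ (t, x)) s with hm
  have hmM : ∀ s x, m s x ≤ M := fun s x => fwdMax_le_const (fun t => hφM (t, x)) s
  have hmt : ∀ s x, m s x ≠ ∞ := fun s x => ((hmM s x).trans_lt hM.lt_top).ne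
  have hmm : Measurable (Function.uncurry m) := measurable_fwdMax_prod (φ := fun t x => φ (t, x)) hφ
  have hms : ∀ s, Measurable (m s) := fun s => hmm.comp measurable_prodMk_left
  have hm0 : ∀ s x, x ∉ Metric.closedBall 0 R → m s x = 0 := fun s x hx => by
    refine le_antisymm (fwdMax_le_const (fun t => (hφR (t, x) fun hz => hx ?_).le) s) zero_le
    rw [mem_closedBall_zero_iff] at hz ⊢
    exact (norm_snd_le (t, x)).trans hz
  have hmq : ∀ s, ∫⁻ x, m s x ^ q ≠ ∞ := by
    intro s
    have : ∫⁻ x, m s x ^ q ≤ ∫⁻ x, (Metric.closedBall (0 : E) R).indicator (fun _ => M ^ q) x := by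
      refine lintegral_mono fun x => ?_
      by_cases hx : x ∈ Metric.closedBall (0 : E) R
      · rw [Set.indicator_of_mem hx]
        exact ENNReal.rpow_le_rpow (hmM s x) hq0.le
      · rw [hm0 s x hx, zero_rpow_of_pos hq0]
        exact zero_le
    rw [lintegral_indicator_const measurableSet_closedBall] at this
    exact (this.trans_lt (mul_lt_top (rpow_lt_top_of_nonneg hq0.le hM)
      measure_closedBall_lt_top)).ne
  set K := ENNReal.ofReal (2 * (squareConst d * C)) with hK
  have hB : Measurable fun s => ∫⁻ x, m s x ^ q :=
    (hmm.pow_const q).lintegral_prod_right'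
  have hCm : Measurable fun s => ∫⁻ θ, c (s, θ) ∂τ := hc.lintegral_prod_right'
  have step := lintegral_causalMajorant_mul_le (σ := σ) (τ := τ) hγ hh hc hct hφ
    (B := fun s => K * (∫⁻ x, m s x ^ q) ^ (1 / q)) ((hB.pow_const _).const_mul _) (fun a => by
      have hX : ∫⁻ x, ENNReal.ofReal (‖h a x‖ ^ (2 * κ)) ≠ ∞ := by
        intro h
        have := hch a
        rw [h, top_rpow_of_pos hq.one_div_pos] at this
        exact (rpow_lt_top_of_nonneg (by linarith) (hct a)).ne this
      have e : ∀ x, ENNReal.ofReal (m a.1 x).toReal = m a.1 x := fun x => ofReal_toReal (hmt a.1 x)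
      have := lintegral_gradMajorant_mul_le_rpow hq hC0 hC (hhb a) hX
        (m := fun x => (m a.1 x).toReal)
        ⟨(hms a.1).ennreal_toReal.stronglyMeasurable, M.toReal, fun x => by
          rw [Real.norm_of_nonneg toReal_nonneg]
          exact toReal_mono hM (hmM a.1 x)⟩ (fun _ => toReal_nonneg)
        (by simpa only [e] using hmq a.1)
        (φ := fun r x => φ (a.1 + r, x)) (hφ.comp (f := fun q : ℝ × E => (a.1 + q.1, q.2))
          (by fun_prop)) (fun x k => by
          rw [e]
          exact lintegral_Ioc_le_mul_fwdMax (fun t => φ (t, x)) a.1 k)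
      simp only [e] at this
      rw [hch a, mul_left_comm]
      exact this)
  have maximal : ∫⁻ s, (∫⁻ x, m s x ^ q) ∂σ ≤
      ENNReal.ofReal (20 * q / (q - 1) * 2 ^ (q - 1)) * ∫⁻ z, φ z ^ q := by
    calc _ ≤ ∫⁻ s, ∫⁻ x, m s x ^ q := lintegral_mono' hσ le_rfl
      _ = ∫⁻ x, ∫⁻ s, m s x ^ q := lintegral_lintegral_swap (hmm.pow_const q).aemeasurable
      _ ≤ ∫⁻ x, ENNReal.ofReal (20 * q / (q - 1) * 2 ^ (q - 1)) * ∫⁻ t, φ (t, x) ^ q :=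
        lintegral_mono fun x => lintegral_fwdMax_rpow_le hq1
          (hφ.comp measurable_prodMk_right) hM fun t => hφM (t, x)
      _ = _ := by
        rw [lintegral_const_mul' _ _ ofReal_ne_top, Measure.volume_eq_prod,
          lintegral_prod_symm _ (hφ.pow_const q).aemeasurable]
  have hD : 0 ≤ 20 * q / (q - 1) * 2 ^ (q - 1) := by
    have : 0 < q - 1 := by linarith
    positivity
  calc _ ≤ _ := step
    _ = K * ∫⁻ s, ((fun s => (∫⁻ θ, c (s, θ) ∂τ) ^ γ) * fun s => (∫⁻ x, m s x ^ q) ^ (1 / q)) s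
          ∂σ := by
        simp_rw [mul_left_comm _ K]
        exact lintegral_const_mul' _ _ ofReal_ne_top
    _ ≤ K * ((∫⁻ s, (∫⁻ θ, c (s, θ) ∂τ) ^ (γ * κ) ∂σ) ^ (1 / κ) *
          (∫⁻ s, (∫⁻ x, m s x ^ q) ∂σ) ^ (1 / q)) := by
        gcongr
        refine (ENNReal.lintegral_mul_le_Lp_mul_Lq σ hq (hCm.pow_const _).aemeasurable
          (hB.pow_const _).aemeasurable).trans_eq ?_
        simp_rw [← ENNReal.rpow_mul, one_div_mul_cancel hq0.ne', ENNReal.rpow_one]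
    _ ≤ K * ((∫⁻ s, (∫⁻ θ, c (s, θ) ∂τ) ^ (γ * κ) ∂σ) ^ (1 / κ) *
          (ENNReal.ofReal (20 * q / (q - 1) * 2 ^ (q - 1)) * ∫⁻ z, φ z ^ q) ^ (1 / q)) := by
        gcongr
    _ = _ := by
        rw [mul_rpow_of_nonneg _ _ hq.symm.one_div_nonneg, dualConst,
          ofReal_mul (mul_nonneg zero_le_two (mul_nonneg squareConst_nonneg hC0)),
          ofReal_rpow_of_nonneg hD hq.symm.one_div_nonneg]
        ring

theorem exists_lintegral_causalMajorant_rpow_le (d : ℕ) {κ : ℝ} (hκ : 1 ≤ κ) :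
    ∃ N : ℝ, 0 < N ∧ ∀ (V : Type*) [NormedAddCommGroup V] [InnerProductSpace ℝ V]
      [CompleteSpace V] (σ τ : Measure ℝ) [SFinite σ] [SFinite τ] (γ : ℝ)
      (h : ℝ × ℝ → EuclideanSpace ℝ (Fin d) → V) (c : ℝ × ℝ → ℝ≥0∞), σ ≤ volume → 1 < γ →
      StronglyMeasurable (Function.uncurry h) → (∀ a, BddMeas (h a)) → Measurable c →
      (∀ a, c a ≠ ∞) →
      (∀ a, c a ^ γ = (∫⁻ x, ENNReal.ofReal (‖h a x‖ ^ (2 * κ))) ^ (1 / κ)) →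
      ∫⁻ z, causalMajorant d (σ.prod τ) (holderWeight τ γ c) h z ^ κ ≤
        ENNReal.ofReal N * ∫⁻ s, (∫⁻ θ, c (s, θ) ∂τ) ^ (γ * κ) ∂σ := by
  rcases hκ.eq_or_lt with rfl | hκ
  · refine ⟨squareConst d + 1, by linarith [squareConst_nonneg (d := d)], ?_⟩
    intro V _ _ _ σ τ _ _ γ h c _ hγ hh hhb hc hct hch
    have := lintegral_causalMajorant_mul_le (σ := σ) (τ := τ) hγ hh hc hct (φ := fun _ => 1)
      measurable_const (B := fun _ => ENNReal.ofReal (squareConst d)) measurable_const fun a => by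
      rw [hch a]
      simpa [mul_comm] using lintegral_gradMajorant_le (hhb a)
    simp only [mul_one, ENNReal.rpow_one] at this ⊢
    refine this.trans ?_
    rw [lintegral_mul_const' _ _ ofReal_ne_top, mul_comm]
    gcongr
    linarith
  · obtain ⟨q, hq⟩ : ∃ q, κ.HolderConjugate q := ⟨_, Real.HolderConjugate.conjExponent hκ⟩
    obtain ⟨C, hC0, hC⟩ := exists_bellman_le hq
    have hD : 0 ≤ dualConst d q C := by
      have := hq.symm.sub_one_pos
      have := hq.symm.pos
      have := squareConst_nonneg (d := d)
      unfold dualConst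
      positivity
    refine ⟨dualConst d q C ^ κ + 1, by positivity, ?_⟩
    intro V _ _ _ σ τ _ _ γ h c hσ hγ hh hhb hc hct hch
    refine (lintegral_rpow_le_of_forall_mul_le hq
      (measurable_causalMajorant hh (measurable_holderWeight hc))
      (S := fun n : ℕ => Metric.closedBall 0 n) (fun n => measurableSet_closedBall)
      (fun i j hij => Metric.closedBall_subset_closedBall (by exact_mod_cast hij))
      (fun z => (exists_nat_ge ‖z‖).imp fun n hn => by simpa using hn)
      (fun n => measure_closedBall_lt_top.ne) fun n φ hφ hφM hφS =>
        lintegral_causalMajorant_mul_le_rpow hq hC0 hC hσ hγ hh hhb hc hct hch hφ hφM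
          hφS).trans ?_
    rw [mul_rpow_of_nonneg _ _ hq.nonneg, ← ENNReal.rpow_mul, one_div_mul_cancel hq.pos.ne',
      ENNReal.rpow_one, ofReal_rpow_of_nonneg hD hq.nonneg]
    gcongr
    linarith

end Assembly

section Slices

variable {d : ℕ} {V : Type*} [NormedAddCommGroup V] {p : ℝ}

local notation "E" => EuclideanSpace ℝ (Fin d)

theorem heatOp_zero [NormedSpace ℝ V] [CompleteSpace V] (t : ℝ) : heatOp d t (fun _ => (0 : V)) = fun _ => 0 := by
  funext x
  simp [heatOp]

theorem gradMajorant_zero [NormedSpace ℝ V] [CompleteSpace V] (r : ℝ) (x : E) :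
    gradMajorant d (fun _ => (0 : V)) r x = 0 := by
  simp [gradMajorant, gradBlock, heatOp_zero, heatVar, heatAvg]

theorem gradHeatNormSq_nonneg [NormedSpace ℝ V] [CompleteSpace V] (t : ℝ) (h : E → V) (x : E) :
    0 ≤ gradHeatNormSq d t h x :=
  Finset.sum_nonneg fun _ _ => by positivity

theorem bddMeas_of_hasCompactSupport {h : E → V} (hc : Continuous h) (hs : HasCompactSupport h) :
    BddMeas h :=
  ⟨hc.stronglyMeasurable, hs.exists_bound_of_continuous hc⟩

theorem lintegral_norm_rpow_lt_top (hp : 0 < p) {h : E → V} (hc : Continuous h)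
    (hs : HasCompactSupport h) : ∫⁻ x, ENNReal.ofReal (‖h x‖ ^ p) < ∞ := by
  refine Integrable.lintegral_lt_top (Continuous.integrable_of_hasCompactSupport ?_ ?_)
  · exact hc.norm.rpow_const fun _ => .inr hp.le
  · exact hs.norm.comp_left (g := fun r : ℝ => r ^ p) (Real.zero_rpow hp.ne')

theorem eq_zero_of_lintegral_norm_rpow_eq_zero (hp : 0 < p) {h : E → V} (hc : Continuous h)
    (h0 : ∫⁻ x, ENNReal.ofReal (‖h x‖ ^ p) = 0) : h = fun _ => 0 := by
  have hcp : Continuous fun x => ‖h x‖ ^ p := hc.norm.rpow_const fun _ => .inr hp.le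
  rw [lintegral_eq_zero_iff hcp.measurable.ennreal_ofReal] at h0
  refine (hc.ae_eq_iff_eq volume continuous_const).1 ?_
  filter_upwards [h0] with x hx
  simp only [Pi.zero_apply, ofReal_eq_zero] at hx
  have := (Real.rpow_eq_zero (norm_nonneg _) hp.ne').1 (le_antisymm hx (by positivity))
  simpa using this

end Slices

theorem measurableSet_ereal_Ioo (a b : EReal) :
    MeasurableSet {t : ℝ | a < (t : EReal) ∧ (t : EReal) < b} :=
  measurableSet_Ioo.preimage (f := fun t : ℝ => (t : EReal)) measurable_coe_real_ereal

/-- Generalized Littlewood–Paley inequality for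
`L^{1/H}((α,β);V)`-valued functions: for `p ∈ [2,∞)` there is a constant
`N = N(d,p)` such that for every `H ∈ (1/2,1)`, every separable Hilbert space `V`,
every `-∞ ≤ a < b ≤ ∞`, `-∞ ≤ α < β ≤ ∞`, and every jointly measurable
`f(t,x,θ)`, smooth with compact support in `(t,x) ∈ (a,b) × ℝ^d`,
`∫_{ℝ^d} ∫_a^b [∫_a^t (∫_α^β ‖∇T_{t-s}f(s,·,θ)(x)‖^{1/H} dθ)^{2H} ds]^{p/2} dt dx
  ≤ N ∫_a^b [∫_α^β (∫_{ℝ^d} ‖f(t,x,θ)‖^p dx)^{1/(pH)} dθ]^{pH} dt`. -/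
theorem littlewood_paley_LH_valued (d : ℕ) (hd : 1 ≤ d) (p : ℝ) (hp : 2 ≤ p) :
    ∃ N : ℝ, 0 < N ∧
      ∀ (H : ℝ), H ∈ Set.Ioo (1/2 : ℝ) 1 →
      ∀ (V : Type) [NormedAddCommGroup V] [InnerProductSpace ℝ V] [CompleteSpace V]
        [TopologicalSpace.SeparableSpace V]
        (a b : EReal), a < b → ∀ (α β : EReal), α < β →
      ∀ (f : ℝ → EuclideanSpace ℝ (Fin d) → ℝ → V),
        StronglyMeasurable
          (fun q : ℝ × EuclideanSpace ℝ (Fin d) × ℝ => f q.1 q.2.1 q.2.2) →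
        (∀ θ, ContDiff ℝ (⊤ : ℕ∞)
          (fun q : ℝ × EuclideanSpace ℝ (Fin d) => f q.1 q.2 θ)) →
        (∃ K : Set (ℝ × EuclideanSpace ℝ (Fin d)), IsCompact K ∧
          K ⊆ {q : ℝ × EuclideanSpace ℝ (Fin d) |
            a < (q.1 : EReal) ∧ (q.1 : EReal) < b} ∧
          ∀ θ, tsupport (fun q : ℝ × EuclideanSpace ℝ (Fin d) => f q.1 q.2 θ) ⊆ K) →
        (∫⁻ x : EuclideanSpace ℝ (Fin d),
            ∫⁻ t in {t : ℝ | a < (t : EReal) ∧ (t : EReal) < b},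
              (∫⁻ s in {s : ℝ | a < (s : EReal) ∧ s < t},
                (∫⁻ θ in {θ : ℝ | α < (θ : EReal) ∧ (θ : EReal) < β},
                  ENNReal.ofReal
                    ((gradHeatNormSq d (t - s) (fun y => f s y θ) x) ^ (1/(2*H))))
                  ^ (2*H)) ^ (p/2))
          ≤ ENNReal.ofReal N *
            ∫⁻ t in {t : ℝ | a < (t : EReal) ∧ (t : EReal) < b},
              (∫⁻ θ in {θ : ℝ | α < (θ : EReal) ∧ (θ : EReal) < β},
                (∫⁻ x : EuclideanSpace ℝ (Fin d),
                  ENNReal.ofReal (‖f t x θ‖ ^ p)) ^ (1/(p*H))) ^ (p*H) := by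
  obtain ⟨N, hN, hmain⟩ := exists_lintegral_causalMajorant_rpow_le d (κ := p / 2) (by linarith)
  refine ⟨N, hN, ?_⟩
  rintro H ⟨hH, -⟩ V _ _ _ _ a b - α β - f hf hsm ⟨K, hK, -, hsupp⟩
  have hp0 : 0 < p := by linarith
  have hH0 : 0 < H := by linarith
  set h : ℝ × ℝ → EuclideanSpace ℝ (Fin d) → V := fun q y => f q.1 y q.2 with hh
  set c : ℝ × ℝ → ℝ≥0∞ :=
    fun q => (∫⁻ x, ENNReal.ofReal (‖h q x‖ ^ p)) ^ (1 / (p * H)) with hc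
  set J := {t : ℝ | a < (t : EReal) ∧ (t : EReal) < b} with hJ
  set σ := (volume : Measure ℝ).restrict J with hσ
  set τ := (volume : Measure ℝ).restrict {θ : ℝ | α < (θ : EReal) ∧ (θ : EReal) < β} with hτ
  have hmeas : StronglyMeasurable (Function.uncurry h) :=
    hf.comp_measurable (g := fun q : (ℝ × ℝ) × EuclideanSpace ℝ (Fin d) => (q.1.1, q.2, q.1.2))
      (by fun_prop)
  have hcont : ∀ q, Continuous (h q) := fun q => (hsm q.2).continuous.comp
    (f := fun y => (q.1, y)) (by fun_prop)
  have hcs : ∀ q, HasCompactSupport (h q) := fun q =>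
    HasCompactSupport.intro (hK.image continuous_snd) fun y hy => by
      by_contra hne
      exact hy ⟨(q.1, y), hsupp q.2 (subset_tsupport _ hne), rfl⟩
  have hbdd : ∀ q, BddMeas (h q) := fun q => bddMeas_of_hasCompactSupport (hcont q) (hcs q)
  have hcm : Measurable c := by
    refine Measurable.pow_const (Measurable.lintegral_prod_right'
      (f := fun z => ENNReal.ofReal (‖Function.uncurry h z‖ ^ p)) ?_) _
    exact (hmeas.norm.measurable.pow_const p).ennreal_ofReal
  have hct : ∀ q, c q ≠ ∞ := fun q => (rpow_lt_top_of_nonneg (by positivity)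
    (lintegral_norm_rpow_lt_top hp0 (hcont q) (hcs q)).ne).ne
  have hc0 : ∀ q, c q = 0 → h q = fun _ => 0 := fun q hq =>
    eq_zero_of_lintegral_norm_rpow_eq_zero hp0 (hcont q)
      ((ENNReal.rpow_eq_zero_iff_of_pos (by positivity)).1 hq)
  have hγ : 1 < 2 * H := by linarith
  have key := hmain V σ τ (2 * H) h c Measure.restrict_le_self hγ hmeas hbdd hcm hct fun q => by
    rw [hc]
    simp only
    rw [← ENNReal.rpow_mul, mul_div_cancel₀ p two_ne_zero]
    congr 1
    field_simp
  rw [show 2 * H * (p / 2) = p * H by ring] at key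
  refine le_trans ?_ key
  have hcaus : Measurable (causalMajorant d (σ.prod τ) (holderWeight τ (2 * H) c) h) :=
    measurable_causalMajorant hmeas (measurable_holderWeight hcm)
  rw [Measure.volume_eq_prod, lintegral_prod_symm _ (hcaus.pow_const _).aemeasurable]
  refine lintegral_mono fun x => ?_
  refine (setLIntegral_mono' (measurableSet_ereal_Ioo a b) fun t ht => ?_).trans
    (setLIntegral_le_lintegral _ _)
  refine ENNReal.rpow_le_rpow ?_ (by positivity)
  have hQ : Measurable fun q : ℝ × ℝ => holderWeight τ (2 * H) c q *
      (Set.Ioi 0).indicator (fun r => gradMajorant d (h q) r x) (t - q.1) :=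
    (measurable_holderWeight hcm).mul ((measurable_indicator_gradMajorant hmeas).comp
      (f := fun q => (q, t, x)) (by fun_prop))
  rw [causalMajorant, lintegral_prod _ hQ.aemeasurable]
  have hsub : {s : ℝ | a < (s : EReal) ∧ s < t} ⊆ J := fun s hs =>
    ⟨hs.1, (EReal.coe_lt_coe_iff.2 hs.2).trans ht.2⟩
  have hms : MeasurableSet {s : ℝ | a < (s : EReal) ∧ s < t} := by
    simpa only [EReal.coe_lt_coe_iff] using measurableSet_ereal_Ioo a t
  refine (setLIntegral_mono' hms fun s hs => ?_).trans (lintegral_mono_set hsub)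
  have hr : 0 < t - s := sub_pos.2 hs.2
  have hgm : Measurable fun θ => gradMajorant d (h (s, θ)) (t - s) x :=
    (measurable_gradMajorant_prod hmeas).comp (f := fun θ : ℝ => ((s, θ), t - s, x)) (by fun_prop)
  have hcθ : Measurable fun θ => c (s, θ) := hcm.comp measurable_prodMk_left
  calc _ ≤ (∫⁻ θ, gradMajorant d (h (s, θ)) (t - s) x ^ (1 / (2 * H)) ∂τ) ^ (2 * H) := by
        gcongr with θ
        rw [← ofReal_rpow_of_nonneg (gradHeatNormSq_nonneg _ _ _) (by positivity)]
        gcongr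
        exact ofReal_gradHeatNormSq_le_gradMajorant (hbdd (s, θ)) hr x
    _ ≤ (∫⁻ θ, c (s, θ) ^ (1 - 2 * H) * gradMajorant d (h (s, θ)) (t - s) x ∂τ) *
          (∫⁻ θ, c (s, θ) ∂τ) ^ (2 * H - 1) :=
        rpow_lintegral_rpow_le hγ hgm hcθ (fun θ => hct (s, θ)) fun θ hθ => by
          rw [hc0 (s, θ) hθ, gradMajorant_zero]
    _ = _ := by
        rw [mul_comm, ← lintegral_const_mul _ (f := fun θ => c (s, θ) ^ (1 - 2 * H) *
          gradMajorant d (h (s, θ)) (t - s) x) ((hcθ.pow_const _).mul hgm)]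
        refine lintegral_congr fun θ => ?_
        rw [Set.indicator_of_mem (Set.mem_Ioi.2 hr), holderWeight, mul_assoc]
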